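/- arXiv:0909.4577 — 2 statements merged into one kernel-verified Lean document; each statement's English description precedes it below -/
import Mathlib

section
/- Let G be a bicyclic graph with n vertices and matching number m, where 3 ≤ m ≤ ⌊n/2⌋. Then χ(G) ≥ (m+1)/√(n−m+4) + (n−2m+1)/√(n−m+3) + (m−3)/√3 + 1, with equality if and only if G is isomorphic to B_{n,m}. -/
open SimpleGraph

/-- The degree of a vertex (stated via `Set.ncard`, so no decidability assumptions). -/
noncomputable def degR {V : Type*} (G : SimpleGraph V) (v : V) : ℕ :=
  (G.neighborSet v).ncard

/-- The sum-connectivity index `χ(G) = ∑_{uv ∈ E(G)} 1/√(d_G(u)+d_G(v))`. -/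
noncomputable def sumConn {V : Type*} [Fintype V] (G : SimpleGraph V) : ℝ :=
  ∑ e ∈ G.edgeSet.toFinite.toFinset,
    Sym2.lift ⟨fun u v => (1 : ℝ) / Real.sqrt ((degR G u : ℝ) + (degR G v : ℝ)),
      fun u v => by simp [add_comm]⟩ e

/-- The matching number: the maximum size of a set of pairwise non-adjacent edges. -/
noncomputable def matchingNumber {V : Type*} (G : SimpleGraph V) : ℕ :=
  sSup {k | ∃ M : Set (Sym2 V), M ⊆ G.edgeSet ∧
    M.Pairwise (fun e f => ∀ v, v ∈ e → v ∉ f) ∧ M.ncard = k}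

/-- Vertex type of the graph `B_{n,m}`. -/
def BnmVert (n m : ℕ) : Type := Unit ⊕ Fin 4 ⊕ Fin (n - 2 * m + 1) ⊕ (Fin (m - 3) × Fin 2)

instance (n m : ℕ) : Fintype (BnmVert n m) := by unfold BnmVert; infer_instance

def BnmRel (n m : ℕ) : BnmVert n m → BnmVert n m → Prop
  | Sum.inl _, Sum.inr (Sum.inl _) => True
  | Sum.inl _, Sum.inr (Sum.inr (Sum.inl _)) => True
  | Sum.inl _, Sum.inr (Sum.inr (Sum.inr (_, j))) => j = 0
  | Sum.inr (Sum.inl i), Sum.inr (Sum.inl i') => (i = 0 ∧ i' = 1) ∨ (i = 2 ∧ i' = 3)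
  | Sum.inr (Sum.inr (Sum.inr (k, j))), Sum.inr (Sum.inr (Sum.inr (k', j'))) =>
      k = k' ∧ j = 0 ∧ j' = 1
  | _, _ => False

/-- The graph `B_{n,m}`: two triangles sharing a common vertex (`Sum.inl ()`), with
`n - 2m + 1` pendent vertices and `m - 3` paths on two vertices attached to the
common vertex. -/
def BnmGraph (n m : ℕ) : SimpleGraph (BnmVert n m) := SimpleGraph.fromRel (BnmRel n m)

/-- The weight `1 / √s` of an edge whose end degrees sum to `s`. -/
noncomputable def edgeWt (s : ℕ) : ℝ := 1 / Real.sqrt s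

/-- The second difference of `edgeWt`. -/
noncomputable def wtDiff (d : ℕ) : ℝ := edgeWt d - 2 * edgeWt (d + 1) + edgeWt (d + 2)

/-- The least increase of the sum-connectivity index when a leaf is attached, raising the degree
of its neighbour to `d` and the number of leaves there to `p`. -/
noncomputable def leafGain (p : ℝ) (d : ℕ) : ℝ :=
  edgeWt d - p * wtDiff d - d * (edgeWt (d + 1) - edgeWt (d + 2))

lemma edgeWt_pos {d : ℕ} (hd : 1 ≤ d) : 0 < edgeWt d := by
  have : (0 : ℝ) < d := by exact_mod_cast hd
  unfold edgeWt; positivity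

lemma wtDiff_aux {a b e : ℝ} (ha : 0 < a) (hb : 0 < b) (he : 0 < e) (hab : b ^ 2 = a ^ 2 + 1)
    (hae : e ^ 2 = a ^ 2 + 2) :
    1 / a - 2 * (1 / b) + 1 / e =
      2 * (a + b + e) / (a * b * e * (a + b) * (b + e) * (a + e)) := by
  rw [eq_div_iff (by positivity)]
  field_simp
  have h1 : (b - a) * (b + a) = 1 := by linarith
  have h2 : (e - b) * (e + b) = 1 := by linarith
  have h3 : (e - a) * (e + a) = 2 := by linarith
  linear_combination e * (b + e) * (a + e) * h1 - a * (a + b) * (a + e) * h2 + (a + e) * hae +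
    b * h3

lemma sqrt_facts {d : ℕ} (hd : 1 ≤ d) (k : ℕ) :
    0 < Real.sqrt ((d + k : ℕ) : ℝ) ∧ Real.sqrt ((d + k : ℕ) : ℝ) ^ 2 = d + k := by
  have : (0 : ℝ) < ((d + k : ℕ) : ℝ) := by exact_mod_cast (by omega : 0 < d + k)
  refine ⟨Real.sqrt_pos.2 this, ?_⟩
  rw [Real.sq_sqrt this.le]; push_cast; ring

lemma wtDiff_eq {d : ℕ} (hd : 1 ≤ d) :
    ∃ a b e f : ℝ, 0 < a ∧ 0 < b ∧ 0 < e ∧ 0 < f ∧ a ^ 2 = d ∧ b ^ 2 = d + 1 ∧ e ^ 2 = d + 2 ∧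
      f ^ 2 = d + 3 ∧ edgeWt (d + 1) - edgeWt (d + 3) = 2 / (b * f * (b + f)) ∧
      wtDiff d = 2 * (a + b + e) / (a * b * e * (a + b) * (b + e) * (a + e)) ∧
      wtDiff (d + 1) = 2 * (b + e + f) / (b * e * f * (b + e) * (e + f) * (b + f)) := by
  obtain ⟨a0, a1⟩ := sqrt_facts hd 0
  obtain ⟨b0, b1⟩ := sqrt_facts hd 1
  obtain ⟨e0, e1⟩ := sqrt_facts hd 2
  obtain ⟨f0, f1⟩ := sqrt_facts hd 3
  push_cast at a1 b1 e1 f1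
  simp only [Nat.cast_add, Nat.cast_one, Nat.cast_ofNat, add_zero] at a0 b0 e0 f0 a1
  refine ⟨_, _, _, _, a0, b0, e0, f0, a1, b1, e1, f1, ?_, ?_, ?_⟩
  · unfold edgeWt
    push_cast
    rw [eq_div_iff (by positivity)]
    field_simp
    linear_combination f1 - b1
  · rw [← wtDiff_aux a0 b0 e0 (by linarith) (by linarith)]
    simp [wtDiff, edgeWt]
  · rw [← wtDiff_aux b0 e0 f0 (by linarith) (by linarith)]
    simp only [wtDiff, edgeWt]
    push_cast
    norm_num [add_assoc]

lemma wtDiff_pos {d : ℕ} (hd : 1 ≤ d) : 0 < wtDiff d := by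
  obtain ⟨a, b, e, f, ha, hb, he, hf, -, -, -, -, -, h, -⟩ := wtDiff_eq hd
  rw [h]; positivity

lemma wtDiff_anti {d : ℕ} (hd : 1 ≤ d) : wtDiff (d + 1) ≤ wtDiff d := by
  obtain ⟨a, b, e, f, ha, hb, he, hf, a2, b2, e2, f2, -, h, h'⟩ := wtDiff_eq hd
  rw [h, h', div_le_div_iff₀ (by positivity) (by positivity)]
  have haf : 0 ≤ f - a := by
    have : a ≤ f := (abs_le_of_sq_le_sq' (by linarith) hf.le).2
    linarith
  have key : (a + b) * (a + e) * (b + e + f) ≤ (a + b + e) * (b + f) * (e + f) := by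
    have : 0 ≤ (f - a) * (a * f + (b + e) * (f + a) + b ^ 2 + b * e + e ^ 2) := by positivity
    linarith
  have k2 : a * ((a + b) * (a + e) * (b + e + f)) ≤ f * ((a + b + e) * (b + f) * (e + f)) :=
    mul_le_mul (by linarith) key (by positivity) hf.le
  have := mul_le_mul_of_nonneg_left k2 (by positivity : 0 ≤ 2 * (b * e * (b + e)))
  linarith

lemma mul_wtDiff_lt {d : ℕ} (hd : 2 ≤ d) :
    d * wtDiff d < edgeWt (d + 1) - edgeWt (d + 3) := by
  obtain ⟨a, b, e, f, ha, hb, he, hf, a2, b2, e2, f2, h0, h, -⟩ :=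
    wtDiff_eq (d := d) (by omega)
  have hd' : (2 : ℝ) ≤ d := by exact_mod_cast hd
  set x : ℝ := (d : ℝ) with hx
  rw [h0, h, ← a2, mul_div_assoc', div_lt_div_iff₀ (by positivity) (by positivity)]
  have sqle : ∀ {u v : ℝ}, 0 < v → u ^ 2 ≤ v ^ 2 → u ≤ v := fun hv h =>
    (abs_le_of_sq_le_sq' h hv.le).2
  have haf : a * f ≤ b * e := by
    apply sqle (by positivity); rw [mul_pow, mul_pow, a2, b2, e2, f2]; nlinarith
  have hbf : b * f ≤ e ^ 2 := by
    apply sqle (by positivity); rw [mul_pow, b2, e2, f2]; nlinarith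
  have hab : x + 0.4 ≤ a * b := by
    apply sqle (by positivity); rw [mul_pow, a2, b2]; nlinarith
  have hab' : a * b ≤ x + 0.5 := by
    apply sqle (by positivity); rw [mul_pow, a2, b2]; nlinarith
  have hbe : x + 1.4 ≤ b * e := by
    apply sqle (by positivity); rw [mul_pow, b2, e2]; nlinarith
  have hae : x + 0.8 ≤ a * e := by
    apply sqle (by positivity); rw [mul_pow, a2, e2]; nlinarith
  have hea : 0.7 * e ≤ a := by
    apply sqle ha; rw [mul_pow, e2, a2]; linarith
  have hba : a ≤ b := by
    apply sqle hb; linarith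
  have k1 : (a + b + e) * (b ^ 2 + e ^ 2) < (a + b) * (b + e) * (a + e) := by
    have e1 : (a + b) * (b + e) * (a + e) = (a + b + e) * (a * b + b * e + a * e) - a * b * e := by
      ring
    rw [e1, b2, e2]
    have i1 : a * b * e ≤ (x + 0.5) * e := by gcongr
    have i2 : 2.4 * e * (x - 0.4) ≤ (a + b + e) * (a * b + b * e + a * e - (x + 1 + (x + 2))) :=
      mul_le_mul (by linarith) (by linarith) (by linarith) (by positivity)
    nlinarith
  have k2 : (a * f) * ((a + b + e) * (b * (b + f))) ≤
      (b * e) * ((a + b + e) * (b ^ 2 + e ^ 2)) := by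
    apply mul_le_mul haf _ (by positivity) (by positivity)
    gcongr
    nlinarith
  have k3 : (b * e) * ((a + b + e) * (b ^ 2 + e ^ 2)) <
      (b * e) * ((a + b) * (b + e) * (a + e)) := by gcongr
  have := mul_lt_mul_of_pos_left (k2.trans_lt k3) (by positivity : 0 < 2 * a)
  linarith

lemma leafGain_succ_lt {p : ℝ} {d : ℕ} (hd : 2 ≤ d) (hp : p ≤ d) :
    leafGain p (d + 1) < leafGain p d - (if p ≤ d - 1 then wtDiff d else 0) := by
  have k1 := mul_wtDiff_lt hd
  have k3 := wtDiff_anti (d := d) (by omega)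
  have k4 := wtDiff_pos (d := d + 1) (by omega)
  have e3 : d + 1 + 2 = d + 3 := rfl
  have e2 : d + 1 + 1 = d + 2 := rfl
  have hA : leafGain p (d + 1) - leafGain p d =
      p * (wtDiff d - wtDiff (d + 1)) + d * wtDiff (d + 1) - wtDiff d
        - (edgeWt (d + 1) - edgeWt (d + 3)) := by
    simp only [leafGain, wtDiff, e3, e2]; push_cast; ring
  split_ifs with h
  · have := mul_le_mul_of_nonneg_right h (sub_nonneg.2 k3)
    nlinarith
  · have := mul_le_mul_of_nonneg_right hp (sub_nonneg.2 k3)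
    nlinarith [wtDiff_pos (d := d) (by omega)]

lemma leafGain_le_left {p q : ℝ} {d : ℕ} (hd : 1 ≤ d) (h : p ≤ q) :
    leafGain q d ≤ leafGain p d := by
  have := mul_le_mul_of_nonneg_right h (wtDiff_pos hd).le
  unfold leafGain; linarith

lemma leafGain_add_lt {p : ℝ} {d : ℕ} (hd : 2 ≤ d) (hp : p ≤ d) (k : ℕ) :
    leafGain p (d + (k + 1)) < leafGain p d := by
  induction k with
  | zero =>
    have := leafGain_succ_lt hd hp
    have h := wtDiff_pos (d := d) (by omega)
    split_ifs at this <;> simp only [zero_add] <;> linarith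
  | succ k ih =>
    have := leafGain_succ_lt (p := p) (d := d + (k + 1)) (by omega) (by push_cast; linarith)
    have h := wtDiff_pos (d := d + (k + 1)) (by omega)
    rw [← add_assoc d (k + 1) 1]
    split_ifs at this <;> linarith

/-- `leafGain` is antitone in the number of leaves and strictly antitone in the degree. -/
lemma leafGain_le {p q : ℝ} {d e : ℕ} (hd : 2 ≤ d) (hp : p ≤ d) (hpq : p ≤ q) (hde : d ≤ e) :
    leafGain q e ≤ leafGain p d ∧ (leafGain q e = leafGain p d → d = e) := by
  have h1 := leafGain_le_left (d := e) (by omega) hpq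
  rcases hde.eq_or_lt with rfl | h
  · exact ⟨h1, fun _ => rfl⟩
  · obtain ⟨k, rfl⟩ := Nat.exists_eq_add_of_lt h
    have := leafGain_add_lt hd hp k
    rw [add_assoc] at *
    exact ⟨by linarith, fun h => by linarith⟩

/-- The least increase, up to the constant `edgeWt 3`, of the sum-connectivity index when a path on
two vertices is attached. -/
noncomputable def pathGain (p : ℝ) (d : ℕ) : ℝ :=
  leafGain p d - (edgeWt d - edgeWt (d + 1))

lemma pathGain_add_lt {p : ℝ} {d : ℕ} (hd : 2 ≤ d) (hp : p ≤ d - 1) (k : ℕ) :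
    pathGain p (d + (k + 1)) < pathGain p d := by
  have step : ∀ e : ℕ, 2 ≤ e → p ≤ e - 1 → pathGain p (e + 1) < pathGain p e := by
    intro e he hpe
    have := leafGain_succ_lt (p := p) he (by linarith)
    rw [if_pos hpe] at this
    have e2 : e + 1 + 1 = e + 2 := rfl
    simp only [pathGain, wtDiff, e2] at *
    linarith
  induction k with
  | zero => exact step d hd hp
  | succ k ih =>
    have := step (d + (k + 1)) (by omega) (by push_cast; linarith)
    rw [← add_assoc d (k + 1) 1]
    linarith

lemma pathGain_le {p q : ℝ} {d e : ℕ} (hd : 2 ≤ d) (hp : p ≤ d - 1) (hpq : p ≤ q) (hde : d ≤ e) :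
    pathGain q e ≤ pathGain p d ∧ (pathGain q e = pathGain p d → d = e) := by
  have h1 : pathGain q e ≤ pathGain p e := by
    have := leafGain_le_left (d := e) (by omega) hpq
    unfold pathGain; linarith
  rcases hde.eq_or_lt with rfl | h
  · exact ⟨h1, fun _ => rfl⟩
  · obtain ⟨k, rfl⟩ := Nat.exists_eq_add_of_lt h
    have := pathGain_add_lt hd hp k
    rw [add_assoc] at *
    exact ⟨by linarith, fun h => by linarith⟩

/-- The extremal value for `2 * m + r` vertices and matching number `m`. -/
noncomputable def extremal (r m : ℕ) : ℝ :=
  (m + 1) * edgeWt (m + r + 4) + (r + 1) * edgeWt (m + r + 3) + (m - 3) * edgeWt 3 + 1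

lemma extremal_succ_left (r m : ℕ) :
    extremal (r + 1) m = extremal r m + leafGain (r + 2) (m + r + 3) := by
  simp only [extremal, leafGain, wtDiff]
  rw [show m + (r + 1) + 4 = m + r + 3 + 2 by ring, show m + (r + 1) + 3 = m + r + 3 + 1 by ring,
    show m + r + 4 = m + r + 3 + 1 by ring]
  push_cast; ring

lemma extremal_succ_right (r m : ℕ) :
    extremal r (m + 1) = extremal r m + edgeWt 3 + pathGain (r + 1) (m + r + 3) := by
  simp only [extremal, pathGain, leafGain, wtDiff]
  rw [show m + 1 + r + 4 = m + r + 3 + 2 by ring, show m + 1 + r + 3 = m + r + 3 + 1 by ring,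
    show m + r + 4 = m + r + 3 + 1 by ring]
  push_cast; ring

lemma le_edgeWt {q : ℝ} {s : ℕ} (hs : 1 ≤ s) (h : q ^ 2 * s ≤ 1) : q ≤ edgeWt s := by
  have hs' : (0 : ℝ) < s := by exact_mod_cast hs
  unfold edgeWt
  refine (abs_le_of_sq_le_sq' ?_ (by positivity)).2
  rw [div_pow, Real.sq_sqrt hs'.le, one_pow, le_div_iff₀ hs']
  exact h

lemma edgeWt_le {q : ℝ} {s : ℕ} (hs : 1 ≤ s) (hq : 0 ≤ q) (h : 1 ≤ q ^ 2 * s) : edgeWt s ≤ q := by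
  have hs' : (0 : ℝ) < s := by exact_mod_cast hs
  unfold edgeWt
  refine (abs_le_of_sq_le_sq' ?_ hq).2
  rw [div_pow, Real.sq_sqrt hs'.le, one_pow, div_le_iff₀ hs']
  exact h

lemma edgeWt_four : edgeWt 4 = 1 / 2 := by
  have : Real.sqrt 4 = 2 := by
    rw [show (4 : ℝ) = 2 ^ 2 by norm_num, Real.sqrt_sq (by norm_num)]
  simp [edgeWt, this]

lemma edgeWt_bounds :
    (0.57735 ≤ edgeWt 3 ∧ edgeWt 3 ≤ 0.57736) ∧ (0.44721 ≤ edgeWt 5 ∧ edgeWt 5 ≤ 0.44722) ∧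
    (0.40824 ≤ edgeWt 6 ∧ edgeWt 6 ≤ 0.40825) ∧ (0.37796 ≤ edgeWt 7 ∧ edgeWt 7 ≤ 0.37797) ∧
    (0.35355 ≤ edgeWt 8 ∧ edgeWt 8 ≤ 0.35356) ∧ (0.33333 ≤ edgeWt 9 ∧ edgeWt 9 ≤ 0.33334) := by
  refine ⟨⟨?_, ?_⟩, ⟨?_, ?_⟩, ⟨?_, ?_⟩, ⟨?_, ?_⟩, ⟨?_, ?_⟩, ⟨?_, ?_⟩⟩
  all_goals first
    | (apply le_edgeWt <;> norm_num)
    | (apply edgeWt_le <;> norm_num)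

lemma leafGain_small {p : ℝ} {d : ℕ} (hp : 2 ≤ p) (hd : 5 ≤ d) : leafGain p d ≤ 0.28 := by
  have := (leafGain_le (p := 2) (q := p) (d := 5) (e := d) (by norm_num) (by norm_num) hp hd).1
  obtain ⟨-, h5, h6, h7, -⟩ := edgeWt_bounds
  have e : leafGain 2 5 = -edgeWt 5 - edgeWt 6 + 3 * edgeWt 7 := by
    simp only [leafGain, wtDiff]; push_cast; ring
  linarith

lemma extremal_le_add {m : ℕ} {s : ℕ} (hms : 2 ≤ m + s) (r : ℕ) :
    extremal (s + r) m ≤ extremal s m + 0.28 * r := by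
  induction r with
  | zero => simp
  | succ r ih =>
    rw [← add_assoc, extremal_succ_left]
    have := leafGain_small (p := ((s + r : ℕ) : ℝ) + 2) (d := m + (s + r) + 3)
      (by
        push_cast
        linarith [(Nat.cast_nonneg s : (0 : ℝ) ≤ s), (Nat.cast_nonneg r : (0 : ℝ) ≤ r)])
      (by omega)
    push_cast at *
    linarith

lemma extremal_zero_le {m : ℕ} (hm : 4 ≤ m) : extremal 0 m ≤ 3.7232 + 0.79 * (m - 4) := by
  obtain ⟨h3, h5, h6, h7, h8, h9⟩ := edgeWt_bounds
  induction m, hm using Nat.le_induction with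
  | base =>
    simp only [extremal]; push_cast; norm_num; linarith
  | succ m hm ih =>
    rw [extremal_succ_right]
    have := (pathGain_le (p := 1) (q := (0 : ℕ) + 1) (d := 7) (e := m + 0 + 3) (by norm_num)
      (by norm_num) (by norm_num) (by omega)).1
    have e : pathGain 1 7 = 6 * edgeWt 9 - 4 * edgeWt 8 - edgeWt 7 := by
      simp only [pathGain, leafGain, wtDiff]; push_cast; ring
    simp only [Nat.cast_zero, zero_add, add_zero] at this ⊢
    push_cast
    linarith

lemma extremal_le_of_four_le {m : ℕ} (hm : 4 ≤ m) (r : ℕ) :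
    extremal r m ≤ 3.7232 + 0.79 * (m - 4) + 0.28 * r := by
  have := extremal_le_add (m := m) (s := 0) (by omega) r
  rw [zero_add] at this
  linarith [extremal_zero_le hm]

lemma extremal_zero_three : extremal 0 3 = 4 * edgeWt 7 + edgeWt 6 + 1 := by
  simp only [extremal]; norm_num

lemma extremal_three_le (r : ℕ) : extremal r 3 ≤ 2.9202 + 0.28 * r := by
  have := extremal_le_add (m := 3) (s := 0) (by omega) r
  obtain ⟨h3, h5, h6, h7, h8, h9⟩ := edgeWt_bounds
  rw [zero_add, extremal_zero_three] at this
  linarith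

lemma extremal_two_le (r : ℕ) : extremal r 2 ≤ 2.0957 + 0.28 * r := by
  have := extremal_le_add (m := 2) (s := 0) (by omega) r
  obtain ⟨h3, h5, h6, h7, h8, h9⟩ := edgeWt_bounds
  have e : extremal 0 2 = 3 * edgeWt 6 + edgeWt 5 - edgeWt 3 + 1 := by
    simp only [extremal]; norm_num; ring
  rw [zero_add] at this
  linarith

lemma extremal_one_le (r : ℕ) : extremal (2 + r) 1 ≤ 1.8267 + 0.28 * r := by
  have := extremal_le_add (m := 1) (s := 2) (by omega) r
  obtain ⟨h3, h5, h6, h7, h8, h9⟩ := edgeWt_bounds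
  have e : extremal 2 1 = 2 * edgeWt 7 + 3 * edgeWt 6 - 2 * edgeWt 3 + 1 := by
    simp only [extremal]; norm_num; ring
  linarith

section Graph

open scoped Classical

/-- The neighbours of a vertex as a finset. -/
noncomputable def nb {V : Type*} [Fintype V] (G : SimpleGraph V) (v : V) : Finset V :=
  (G.neighborSet v).toFinite.toFinset

lemma mem_nb {V : Type*} [Fintype V] {G : SimpleGraph V} {u v : V} :
    v ∈ nb G u ↔ G.Adj u v := by
  simp [nb]

lemma degR_eq_card {V : Type*} [Fintype V] (G : SimpleGraph V) (v : V) :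
    degR G v = (nb G v).card :=
  Set.ncard_eq_toFinset_card _ _

lemma degR_eq_degree {V : Type*} [Fintype V] (G : SimpleGraph V) (v : V)
    [Fintype (G.neighborSet v)] : degR G v = G.degree v := by
  rw [degR, Set.ncard_eq_toFinset_card', ← SimpleGraph.card_neighborFinset_eq_degree]
  rfl

lemma sum_nb_eq_two_mul {V : Type*} [Fintype V] (G : SimpleGraph V) (φ : Sym2 V → ℝ) :
    ∑ u, ∑ v ∈ nb G u, φ s(u, v) = 2 * ∑ e ∈ G.edgeSet.toFinite.toFinset, φ e := by
  rw [Finset.sum_sigma']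
  rw [← Finset.sum_fiberwise_of_maps_to (t := G.edgeSet.toFinite.toFinset)
    (g := fun p : (_ : V) × V => s(p.1, p.2))]
  · rw [Finset.mul_sum]
    refine Finset.sum_congr rfl fun e he => ?_
    induction e with | _ a b =>
    have hab : G.Adj a b := by simpa using he
    have : (Finset.univ.sigma fun u => nb G u).filter
        (fun p : (_ : V) × V => s(p.1, p.2) = s(a, b)) = {⟨a, b⟩, ⟨b, a⟩} := by
      ext ⟨u, v⟩
      simp only [Finset.mem_filter, Finset.mem_sigma, Finset.mem_univ, true_and, mem_nb,
        Sym2.eq_iff, Finset.mem_insert, Finset.mem_singleton, Sigma.mk.injEq, heq_eq_eq]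
      constructor
      · exact fun h => h.2
      · rintro (⟨rfl, rfl⟩ | ⟨rfl, rfl⟩)
        · exact ⟨hab, by simp⟩
        · exact ⟨hab.symm, by simp⟩
    rw [this, Finset.sum_pair]
    · rw [Sym2.eq_swap]; ring
    · simp only [ne_eq, Sigma.mk.injEq, heq_eq_eq, not_and]
      exact fun h => absurd h hab.ne
  · rintro ⟨u, v⟩ h
    simpa [mem_nb] using h

/-- Twice the sum-connectivity index, as a sum over ordered pairs of adjacent vertices. -/
noncomputable def dartSum {V : Type*} [Fintype V] (G : SimpleGraph V) : ℝ :=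
  ∑ u, ∑ v ∈ nb G u, edgeWt (degR G u + degR G v)

lemma dartSum_eq {V : Type*} [Fintype V] (G : SimpleGraph V) : dartSum G = 2 * sumConn G := by
  rw [sumConn, ← sum_nb_eq_two_mul]
  simp [dartSum, edgeWt]

lemma sum_degR {V : Type*} [Fintype V] (G : SimpleGraph V) :
    ∑ v, degR G v = 2 * G.edgeSet.ncard := by
  have := sum_nb_eq_two_mul G fun _ => 1
  simp only [Finset.sum_const, nsmul_eq_mul, mul_one, ← degR_eq_card,
    ← Set.ncard_eq_toFinset_card] at this
  exact_mod_cast this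

lemma sum_nb_of_center {V : Type*} [Fintype V] (G : SimpleGraph V) (y : V) (T : V → V → ℝ)
    (hT : ∀ u v, T u v = T v u) (h : ∀ u v, G.Adj u v → u ≠ y → v ≠ y → T u v = 0) :
    ∑ u, ∑ v ∈ nb G u, T u v = 2 * ∑ v ∈ nb G y, T y v := by
  have key : ∀ u, ∑ v ∈ nb G u, T u v =
      (if u = y then ∑ v ∈ nb G y, T y v else 0) + (if u ∈ nb G y then T y u else 0) := by
    intro u
    by_cases hu : u = y
    · subst hu
      simp [mem_nb]
    · rw [if_neg hu, zero_add]
      split_ifs with hy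
      · rw [Finset.sum_eq_single_of_mem y (mem_nb.2 (mem_nb.1 hy).symm)]
        · exact hT _ _
        · exact fun v hv hvy => h u v (mem_nb.1 hv) hu hvy
      · refine Finset.sum_eq_zero fun v hv => h u v (mem_nb.1 hv) hu ?_
        rintro rfl
        exact hy (mem_nb.2 (mem_nb.1 hv).symm)
  rw [Finset.sum_congr rfl fun u _ => key u, Finset.sum_add_distrib]
  simp [two_mul]

/-- The graph obtained by deleting a vertex. -/
abbrev del {V : Type*} (G : SimpleGraph V) (x : V) : SimpleGraph {v : V // v ≠ x} :=
  G.comap Subtype.val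

lemma sum_nb_del {V : Type*} [Fintype V] (G : SimpleGraph V) (x : V) (v : {v : V // v ≠ x})
    {M : Type*} [AddCommMonoid M] (φ : V → M) :
    ∑ w ∈ nb (del G x) v, φ w = ∑ w ∈ (nb G v).erase x, φ w := by
  refine Finset.sum_bij (fun w _ => w.1) ?_ ?_ ?_ ?_
  · intro w hw
    simp only [Finset.mem_erase, mem_nb] at *
    exact ⟨w.2, hw⟩
  · intro a _ b _ h
    exact Subtype.ext h
  · intro b hb
    simp only [Finset.mem_erase, mem_nb] at hb
    exact ⟨⟨b, hb.1⟩, mem_nb.2 hb.2, rfl⟩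
  · intros; rfl

lemma degR_del {V : Type*} [Fintype V] (G : SimpleGraph V) (x : V) (v : {v : V // v ≠ x}) :
    degR (del G x) v = ((nb G v).erase x).card := by
  rw [degR_eq_card]
  simpa using sum_nb_del G x v (fun _ => (1 : ℕ))

lemma degR_del_of_not_adj {V : Type*} [Fintype V] {G : SimpleGraph V} {x : V}
    {v : {v : V // v ≠ x}} (h : ¬ G.Adj v x) : degR (del G x) v = degR G v := by
  rw [degR_del, degR_eq_card, Finset.erase_eq_of_notMem (by rwa [mem_nb])]

lemma degR_del_of_adj {V : Type*} [Fintype V] {G : SimpleGraph V} {x : V}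
    {v : {v : V // v ≠ x}} (h : G.Adj v x) : degR (del G x) v + 1 = degR G v := by
  rw [degR_del, degR_eq_card, Finset.card_erase_add_one (mem_nb.2 h)]

lemma sum_eq_add_del {V : Type*} [Fintype V] (x : V) {M : Type*} [AddCommMonoid M] (φ : V → M) :
    ∑ v, φ v = φ x + ∑ v : {v : V // v ≠ x}, φ v :=
  Fintype.sum_eq_add_sum_subtype_ne φ x

lemma exists_nb_eq {V : Type*} [Fintype V] {G : SimpleGraph V} {x : V} (h : degR G x = 1) :
    ∃ y, nb G x = {y} := by
  rwa [degR_eq_card, Finset.card_eq_one] at h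

lemma dartSum_leaf {V : Type*} [Fintype V] {G : SimpleGraph V} {x y : V} {e : ℕ}
    (hx : nb G x = {y}) (hy : degR G y = e + 1) :
    dartSum G = dartSum (del G x) + 2 * (edgeWt (e + 2) + ∑ v ∈ (nb G y).erase x,
      (edgeWt (e + 1 + degR G v) - edgeWt (e + degR G v))) := by
  have hxy : ∀ v, G.Adj x v ↔ v = y := fun v => by rw [← mem_nb, hx, Finset.mem_singleton]
  have hxy' : G.Adj x y := (hxy y).2 rfl
  set δ : V → ℕ := fun v => if v = y then e else degR G v with hδ
  have hδd : ∀ v : {v : V // v ≠ x}, degR (del G x) v = δ v := by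
    intro v
    by_cases hv : v.1 = y
    · have := degR_del_of_adj (G := G) (x := x) (v := v) (by rw [hv]; exact hxy'.symm)
      simp only [hδ, hv, if_true]
      rw [hv] at this
      omega
    · simp only [hδ, hv, if_false]
      exact degR_del_of_not_adj fun h => hv ((hxy _).1 h.symm)
  set S : V → V → ℝ := fun u v => if u = x ∨ v = x then 0 else edgeWt (δ u + δ v) with hS
  have hH : dartSum (del G x) = ∑ u, ∑ v ∈ nb G u, S u v := by
    rw [sum_eq_add_del x, Finset.sum_eq_zero (s := nb G x) (by simp [hS]), zero_add, dartSum]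
    refine Finset.sum_congr rfl fun u _ => ?_
    simp only [hδd]
    rw [sum_nb_del G x u (fun v => edgeWt (δ u + δ v))]
    rw [← Finset.sum_subset (Finset.erase_subset x (nb G u))]
    · refine Finset.sum_congr rfl fun v hv => ?_
      simp [hS, u.2, (Finset.mem_erase.1 hv).1]
    · intro v hv hv'
      have : v = x := by
        by_contra h
        exact hv' (Finset.mem_erase.2 ⟨h, hv⟩)
      simp [hS, this]
  have hdiff : dartSum G - dartSum (del G x) =
      ∑ u, ∑ v ∈ nb G u, (edgeWt (degR G u + degR G v) - S u v) := by
    rw [hH, dartSum]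
    simp only [Finset.sum_sub_distrib]
  rw [sum_nb_of_center G y] at hdiff
  · rw [← sub_eq_iff_eq_add', hdiff]
    congr 1
    rw [← Finset.add_sum_erase _ _ (mem_nb.2 hxy'.symm)]
    have h1 : degR G x = 1 := by rw [degR_eq_card, hx, Finset.card_singleton]
    congr 1
    · simp [hS, hy, h1]
    · refine Finset.sum_congr rfl fun v hv => ?_
      rw [Finset.mem_erase, mem_nb] at hv
      have hvy : v ≠ y := hv.2.ne'
      simp [hS, hδ, hy, hv.1, hxy'.ne', hvy]
  · intro u v
    simp only [hS, or_comm, add_comm]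
  · intro u v huv hu hv
    have hux : u ≠ x := by rintro rfl; exact hv ((hxy _).1 huv)
    have hvx : v ≠ x := by rintro rfl; exact hu ((hxy _).1 huv.symm)
    simp [hS, hδ, hux, hvx, hu, hv]

/-- The leaves adjacent to a vertex. -/
noncomputable def leafNb {V : Type*} [Fintype V] (G : SimpleGraph V) (v : V) : Finset V :=
  (nb G v).filter fun u => degR G u = 1

lemma edgeWt_sub_antitone {a b : ℕ} (ha : 1 ≤ a) (hab : a ≤ b) :
    edgeWt b - edgeWt (b + 1) ≤ edgeWt a - edgeWt (a + 1) := by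
  induction b, hab using Nat.le_induction with
  | base => rfl
  | succ b hb ih =>
    have h := wtDiff_pos (d := b) (by omega)
    have e2 : b + 1 + 1 = b + 2 := rfl
    simp only [wtDiff, e2] at *
    linarith

lemma dartSum_leaf_ge {V : Type*} [Fintype V] {G : SimpleGraph V} {x y : V}
    (hx : nb G x = {y}) (hpos : ∀ v, 1 ≤ degR G v) :
    dartSum (del G x) + 2 * leafGain (leafNb G y).card (degR G y) ≤ dartSum G := by
  have hxy : ∀ v, G.Adj x v ↔ v = y := fun v => by rw [← mem_nb, hx, Finset.mem_singleton]
  have hxy' : G.Adj x y := (hxy y).2 rfl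
  have h1 : degR G x = 1 := by rw [degR_eq_card, hx, Finset.card_singleton]
  obtain ⟨e, he⟩ : ∃ e, degR G y = e + 1 := ⟨degR G y - 1, by have := hpos y; omega⟩
  rw [dartSum_leaf hx he]
  have hterm : ∀ v ∈ (nb G y).erase x,
      -(edgeWt (e + 2) - edgeWt (e + 3)) - (if degR G v = 1 then wtDiff (e + 1) else 0) ≤
      edgeWt (e + 1 + degR G v) - edgeWt (e + degR G v) := by
    intro v _
    split_ifs with hv
    · have e2 : e + 1 + 1 = e + 2 := rfl
      have e3 : e + 1 + 2 = e + 3 := rfl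
      simp only [hv, wtDiff, e2, e3]
      linarith
    · have := edgeWt_sub_antitone (a := e + 2) (b := e + degR G v) (by omega)
        (by have := hpos v; omega)
      rw [show e + 1 + degR G v = e + degR G v + 1 by ring]
      linarith
  have hsum := Finset.sum_le_sum hterm
  have hc1 : ((nb G y).erase x).card = e := by
    have := Finset.card_erase_add_one (mem_nb.2 hxy'.symm)
    rw [← degR_eq_card, he] at this
    omega
  have hc2 : (((nb G y).erase x).filter fun v => degR G v = 1).card + 1 = (leafNb G y).card := by
    rw [Finset.filter_erase]
    exact Finset.card_erase_add_one (by simp [mem_nb, hxy'.symm, h1])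
  rw [Finset.sum_sub_distrib, Finset.sum_const, hc1, ← Finset.sum_filter, Finset.sum_const] at hsum
  have hc3 : ((leafNb G y).card : ℝ) =
      (((nb G y).erase x).filter fun v => degR G v = 1).card + 1 := by
    exact_mod_cast hc2.symm
  rw [he, hc3]
  simp only [nsmul_eq_mul] at hsum
  have e2 : e + 1 + 1 = e + 2 := rfl
  have e3 : e + 1 + 2 = e + 3 := rfl
  simp only [leafGain, wtDiff, e2, e3] at *
  push_cast
  linarith

/-- A matching presented as an involution moving at least `k` vertices along edges. -/
structure IsMatch {V : Type*} [Fintype V] (G : SimpleGraph V) (f : V → V) (k : ℕ) : Prop where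
  invol : ∀ v, f (f v) = v
  adj : ∀ v, f v ≠ v → G.Adj v (f v)
  le_card : k ≤ (Finset.univ.filter fun v => f v ≠ v).card

lemma IsMatch.del_of_fixed {V : Type*} [Fintype V] {G : SimpleGraph V} {f : V → V} {k : ℕ}
    (hf : IsMatch G f k) {x : V} (hx : f x = x) :
    ∃ f', IsMatch (del G x) f' k ∧ ∀ v, (f' v).1 = f v := by
  have hne : ∀ v : {v : V // v ≠ x}, f v ≠ x := by
    intro v h
    apply v.2
    rw [← hf.invol v, h, hx]
  refine ⟨fun v => ⟨f v, hne v⟩, ⟨fun v => Subtype.ext (hf.invol v), fun v hv => hf.adj v ?_,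
    hf.le_card.trans (Finset.card_le_card_of_surjOn Subtype.val ?_)⟩, fun _ => rfl⟩
  · exact fun h => hv (Subtype.ext h)
  · intro v hv
    simp only [Finset.coe_filter, Finset.mem_univ, true_and, Set.mem_ofPred_eq] at hv
    have : v ≠ x := by rintro rfl; exact hv hx
    exact ⟨⟨v, this⟩, by simpa [Subtype.ext_iff] using hv, rfl⟩

lemma IsMatch.fix {V : Type*} [Fintype V] {G : SimpleGraph V} {f : V → V} {k : ℕ}
    (hf : IsMatch G f (k + 2)) (x : V) : ∃ f', IsMatch G f' k ∧ f' x = x ∧ f' (f x) = f x := by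
  refine ⟨fun v => if v = x ∨ v = f x then v else f v, ⟨?_, ?_, ?_⟩, by simp, by simp⟩
  · intro v
    by_cases hv : v = x ∨ v = f x
    · simp [hv]
    · have hv' : ¬ (f v = x ∨ f v = f x) := by
        rintro (h | h)
        · exact hv (Or.inr (by rw [← h, hf.invol]))
        · exact hv (Or.inl (by rw [← hf.invol v, h, hf.invol]))
      simp [hv, hv', hf.invol]
  · intro v hv
    by_cases h : v = x ∨ v = f x
    · simp [h] at hv
    · simp only [h, if_false] at hv ⊢
      exact hf.adj v hv
  · have hsub : (Finset.univ.filter fun v => f v ≠ v) ⊆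
        (Finset.univ.filter fun v => (if v = x ∨ v = f x then v else f v) ≠ v) ∪ {x, f x} := by
      intro v hv
      simp only [Finset.mem_filter, Finset.mem_univ, true_and, Finset.mem_union,
        Finset.mem_insert, Finset.mem_singleton] at *
      by_cases h : v = x ∨ v = f x
      · exact Or.inr h
      · exact Or.inl (by simpa [h] using hv)
    have h1 := hf.le_card.trans (Finset.card_le_card hsub)
    have h2 := Finset.card_union_le
      (Finset.univ.filter fun v => (if v = x ∨ v = f x then v else f v) ≠ v) {x, f x}
    have h3 : ({x, f x} : Finset V).card ≤ 2 := Finset.card_le_two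
    omega

lemma IsMatch.card_leafNb_add_le {V : Type*} [Fintype V] {G : SimpleGraph V} {f : V → V} {k : ℕ}
    (hf : IsMatch G f k) (y : V) : (leafNb G y).card + k ≤ Fintype.card V + 1 := by
  have hsub : (leafNb G y).erase (f y) ⊆ Finset.univ.filter fun v => ¬ f v ≠ v := by
    intro v hv
    simp only [leafNb, Finset.mem_erase, Finset.mem_filter, mem_nb, Finset.mem_univ, true_and,
      not_not] at *
    by_contra h
    obtain ⟨w, hw⟩ := exists_nb_eq hv.2.2
    have h1 : f v = w := by simpa [hw] using mem_nb.2 (hf.adj v h)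
    have h2 : y = w := by simpa [hw] using mem_nb.2 hv.2.1.symm
    exact hv.1 (by rw [h2, ← h1, hf.invol])
  have h1 := Finset.card_le_card hsub
  have h2 := Finset.pred_card_le_card_erase (s := leafNb G y) (a := f y)
  have h3 := Finset.card_filter_add_card_filter_not (s := (Finset.univ : Finset V))
    (fun v => f v ≠ v)
  have h4 := hf.le_card
  rw [Finset.card_univ] at h3
  omega

lemma IsMatch.degR_bound {V : Type*} [Fintype V] {G : SimpleGraph V} {f : V → V} {k : ℕ}
    (hf : IsMatch G f k) (y : V) : 2 * degR G y + k ≤ (∑ v, degR G v) + 2 := by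
  have hterm : ∀ v, (if v ∈ nb G y then 1 else 0) +
      (if f v ≠ v ∧ v ≠ y ∧ v ≠ f y then 1 else 0) ≤ if v = y then 0 else degR G v := by
    intro v
    by_cases hv : v = y
    · subst hv
      simp [mem_nb]
    · simp only [hv, if_false]
      have hfy : v ≠ f y → f v ≠ y := by
        rintro h rfl
        exact h (hf.invol v).symm
      have hsub : (if v ∈ nb G y then {y} else ∅) ∪
          (if f v ≠ v ∧ v ≠ y ∧ v ≠ f y then {f v} else ∅) ⊆ nb G v := by
        intro w hw
        rw [Finset.mem_union] at hw
        rcases hw with hw | hw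
        · split_ifs at hw with h
          · rw [Finset.mem_singleton.1 hw]
            exact mem_nb.2 (mem_nb.1 h).symm
          · simp at hw
        · split_ifs at hw with h
          · rw [Finset.mem_singleton.1 hw]
            exact mem_nb.2 (hf.adj v h.1)
          · simp at hw
      rw [degR_eq_card]
      refine le_trans (le_of_eq ?_) (Finset.card_le_card hsub)
      rw [Finset.card_union_of_disjoint]
      · congr 1 <;> split_ifs <;> simp
      · split_ifs with h1 h2
        · simpa using (hfy h2.2.2).symm
        all_goals simp
  have hsum := Finset.sum_le_sum fun v (_ : v ∈ Finset.univ) => hterm v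
  rw [Finset.sum_add_distrib, ← Finset.card_filter, ← Finset.card_filter] at hsum
  have e1 : (Finset.univ.filter fun v => v ∈ nb G y).card = degR G y := by
    rw [degR_eq_card]; congr 1; ext; simp
  have e2 : (∑ v, if v = y then 0 else degR G v) + degR G y = ∑ v, degR G v := by
    rw [← Finset.add_sum_erase _ _ (Finset.mem_univ y), if_pos rfl, zero_add,
      ← Finset.add_sum_erase _ (fun v => degR G v) (Finset.mem_univ y), add_comm]
    congr 1
    refine Finset.sum_congr rfl fun v hv => ?_
    rw [if_neg (Finset.mem_erase.1 hv).1]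
  have hsub : (Finset.univ.filter fun v => f v ≠ v) ⊆
      (Finset.univ.filter fun v => f v ≠ v ∧ v ≠ y ∧ v ≠ f y) ∪ {y, f y} := by
    intro v hv
    simp only [Finset.mem_filter, Finset.mem_univ, true_and, Finset.mem_union,
      Finset.mem_insert, Finset.mem_singleton] at *
    tauto
  have h1 := hf.le_card.trans (Finset.card_le_card hsub)
  have h2 := Finset.card_union_le
    (Finset.univ.filter fun v => f v ≠ v ∧ v ≠ y ∧ v ≠ f y) {y, f y}
  have h3 : ({y, f y} : Finset V).card ≤ 2 := Finset.card_le_two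
  omega

lemma exists_isMatch {V : Type*} [Fintype V] (G : SimpleGraph V) :
    ∃ f, IsMatch G f (2 * matchingNumber G) := by
  have hmem : matchingNumber G ∈ {k | ∃ M : Set (Sym2 V), M ⊆ G.edgeSet ∧
      M.Pairwise (fun e f => ∀ v, v ∈ e → v ∉ f) ∧ M.ncard = k} := by
    apply Nat.sSup_mem
    · exact ⟨0, ∅, by simp, by simp, by simp⟩
    · refine ⟨G.edgeSet.ncard, ?_⟩
      rintro k ⟨M, hM, -, rfl⟩
      exact Set.ncard_le_ncard hM (Set.toFinite _)
  obtain ⟨M, hM, hP, hk⟩ := hmem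
  have huniq : ∀ v a b, s(v, a) ∈ M → s(v, b) ∈ M → a = b := by
    intro v a b ha hb
    by_contra hab
    refine hP ha hb ?_ v (by simp) (by simp)
    intro h
    rcases Sym2.eq_iff.1 h with h | h
    · exact hab h.2
    · exact hab (h.2.trans h.1)
  set f : V → V := fun v => if h : ∃ w, s(v, w) ∈ M then h.choose else v with hf
  have hf1 : ∀ v w, s(v, w) ∈ M → f v = w := by
    intro v w h
    have hex : ∃ w, s(v, w) ∈ M := ⟨w, h⟩
    simp only [hf, hex, dif_pos]
    exact huniq v _ _ hex.choose_spec h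
  have hf2 : ∀ v, f v ≠ v → s(v, f v) ∈ M := by
    intro v h
    by_cases hex : ∃ w, s(v, w) ∈ M
    · obtain ⟨w, hw⟩ := hex
      rwa [hf1 v w hw]
    · simp [hf, hex] at h
  have hne : ∀ v w, s(v, w) ∈ M → v ≠ w := fun v w h => G.ne_of_adj (hM h)
  refine ⟨f, fun v => ?_, fun v hv => hM (hf2 v hv), ?_⟩
  · by_cases h : f v = v
    · rw [h, h]
    · exact hf1 _ _ (by rw [Sym2.eq_swap]; exact hf2 v h)
  · have h2 := sum_nb_eq_two_mul (SimpleGraph.fromEdgeSet M) fun _ => 1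
    have hE : (SimpleGraph.fromEdgeSet M).edgeSet = M := by
      rw [SimpleGraph.edgeSet_fromEdgeSet, sdiff_eq_left, Set.disjoint_left]
      exact fun e he => G.not_isDiag_of_mem_edgeSet (hM he)
    simp only [Finset.sum_const, nsmul_eq_mul, mul_one, ← Set.ncard_eq_toFinset_card, hE,
      hk] at h2
    have h3 : ∀ v, (nb (SimpleGraph.fromEdgeSet M) v).card = if f v ≠ v then 1 else 0 := by
      intro v
      split_ifs with h
      · rw [Finset.card_eq_one]
        refine ⟨f v, ?_⟩
        ext w
        simp only [mem_nb, SimpleGraph.fromEdgeSet_adj, Finset.mem_singleton]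
        constructor
        · exact fun h => (hf1 v w h.1).symm
        · rintro rfl
          exact ⟨hf2 v h, h.symm⟩
      · rw [Finset.card_eq_zero, Finset.eq_empty_iff_forall_notMem]
        intro w hw
        rw [mem_nb, SimpleGraph.fromEdgeSet_adj] at hw
        exact h (by rw [hf1 v w hw.1]; exact hw.2.symm)
    rw [Finset.card_filter]
    simp only [h3] at h2
    exact_mod_cast h2.ge

/-- The adjacency pattern of `WGraph`. -/
def WRel (α β : Type) : Unit ⊕ Fin 4 ⊕ α ⊕ (β × Fin 2) → Unit ⊕ Fin 4 ⊕ α ⊕ (β × Fin 2) → Prop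
  | Sum.inl _, Sum.inr (Sum.inl _) => True
  | Sum.inl _, Sum.inr (Sum.inr (Sum.inl _)) => True
  | Sum.inl _, Sum.inr (Sum.inr (Sum.inr (_, j))) => j = 0
  | Sum.inr (Sum.inl i), Sum.inr (Sum.inl i') => (i = 0 ∧ i' = 1) ∨ (i = 2 ∧ i' = 3)
  | Sum.inr (Sum.inr (Sum.inr (k, j))), Sum.inr (Sum.inr (Sum.inr (k', j'))) =>
      k = k' ∧ j = 0 ∧ j' = 1
  | _, _ => False

/-- Two triangles sharing a vertex, with pendent vertices indexed by `α` and pendent paths on two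
vertices indexed by `β` attached to the shared vertex. -/
def WGraph (α β : Type) : SimpleGraph (Unit ⊕ Fin 4 ⊕ α ⊕ (β × Fin 2)) :=
  SimpleGraph.fromRel (WRel α β)

lemma WGraph_adj {α β : Type} {u v : Unit ⊕ Fin 4 ⊕ α ⊕ (β × Fin 2)} :
    (WGraph α β).Adj u v ↔ u ≠ v ∧ (WRel α β u v ∨ WRel α β v u) := Iff.rfl

lemma nb_eq_filter {V : Type*} [Fintype V] (G : SimpleGraph V) (v : V) :
    nb G v = Finset.univ.filter fun u => G.Adj v u := by
  ext; simp [mem_nb]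

lemma degR_eq_sum {V : Type*} [Fintype V] (G : SimpleGraph V) (v : V) :
    degR G v = ∑ u, if G.Adj v u then 1 else 0 := by
  rw [degR_eq_card, nb_eq_filter, Finset.card_filter]

lemma degR_WGraph_center (α β : Type) [Fintype α] [Fintype β] :
    degR (WGraph α β) (Sum.inl ()) = 4 + Fintype.card α + Fintype.card β := by
  simp only [degR_eq_sum, Fintype.sum_sum_type, WGraph_adj, WRel, Fin.sum_univ_four,
    Fintype.sum_prod_type, Fin.sum_univ_two]
  simp [add_assoc]

lemma degR_WGraph_triangle (α β : Type) [Fintype α] [Fintype β] (i : Fin 4) :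
    degR (WGraph α β) (Sum.inr (Sum.inl i)) = 2 := by
  simp only [degR_eq_sum, Fintype.sum_sum_type, WGraph_adj, WRel, Fin.sum_univ_four,
    Fintype.sum_prod_type, Fin.sum_univ_two]
  fin_cases i <;> simp

lemma degR_WGraph_leaf (α β : Type) [Fintype α] [Fintype β] (a : α) :
    degR (WGraph α β) (Sum.inr (Sum.inr (Sum.inl a))) = 1 := by
  simp only [degR_eq_sum, Fintype.sum_sum_type, WGraph_adj, WRel, Fin.sum_univ_four,
    Fintype.sum_prod_type, Fin.sum_univ_two]
  simp

lemma degR_WGraph_path (α β : Type) [Fintype α] [Fintype β] (b : β) (i : Fin 2) :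
    degR (WGraph α β) (Sum.inr (Sum.inr (Sum.inr (b, i)))) = 2 - i := by
  simp only [degR_eq_sum, Fintype.sum_sum_type, WGraph_adj, WRel, Fin.sum_univ_four,
    Fintype.sum_prod_type, Fin.sum_univ_two]
  fin_cases i <;> simp

lemma eq_center_of_degR {α β : Type} [Fintype α] [Fintype β]
    {u : Unit ⊕ Fin 4 ⊕ α ⊕ (β × Fin 2)} (h : 3 ≤ degR (WGraph α β) u) : u = Sum.inl () := by
  rcases u with u | u | u | ⟨b, i⟩
  · rfl
  · simp [degR_WGraph_triangle] at h
  · simp [degR_WGraph_leaf] at h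
  · simp only [degR_WGraph_path] at h; omega

lemma dartSum_eq_sum {V : Type*} [Fintype V] (G : SimpleGraph V) :
    dartSum G = ∑ u, ∑ v, if G.Adj u v then edgeWt (degR G u + degR G v) else 0 := by
  simp [dartSum, nb_eq_filter, Finset.sum_filter]

lemma dartSum_WGraph {α β : Type} [Fintype α] [Fintype β] {r m : ℕ}
    (hα : Fintype.card α = r + 1) (hβ : Fintype.card β + 3 = m) :
    dartSum (WGraph α β) = 2 * extremal r m := by
  subst hβ
  have hc := degR_WGraph_center α β
  generalize hD : degR (WGraph α β) (Sum.inl ()) = D at hc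
  simp only [dartSum_eq_sum, Fintype.sum_sum_type, Fin.sum_univ_four,
    Fintype.sum_prod_type, Fin.sum_univ_two, hD, degR_WGraph_triangle,
    degR_WGraph_leaf, degR_WGraph_path, WGraph_adj, WRel]
  simp [hα, hc]
  simp only [extremal, edgeWt_four]
  push_cast
  ring_nf

lemma degR_iso {V W : Type*} [Fintype V] [Fintype W] {G : SimpleGraph V} {H : SimpleGraph W}
    (e : G ≃g H) (v : V) : degR H (e v) = degR G v := by
  rw [degR_eq_sum, degR_eq_sum, ← Equiv.sum_comp e.toEquiv]
  simp [e.map_adj_iff]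

lemma dartSum_iso {V W : Type*} [Fintype V] [Fintype W] {G : SimpleGraph V} {H : SimpleGraph W}
    (e : G ≃g H) : dartSum H = dartSum G := by
  rw [dartSum_eq_sum, dartSum_eq_sum, ← Equiv.sum_comp e.toEquiv]
  refine Finset.sum_congr rfl fun u _ => ?_
  rw [← Equiv.sum_comp e.toEquiv]
  simp [degR_iso, e.map_adj_iff]

/-- Attaching a leaf extends an isomorphism. -/
lemma exists_iso_of_leaf {X Y V : Type*} [Fintype V] {G : SimpleGraph V} {x : V}
    {H : SimpleGraph X} {H' : SimpleGraph Y} {w : X} (ι : Option X ≃ Y)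
    (hH : ∀ u v, H'.Adj (ι (some u)) (ι (some v)) ↔ H.Adj u v)
    (hι : ∀ v, H'.Adj (ι none) (ι (some v)) ↔ v = w) (e : H ≃g del G x)
    (hx : nb G x = {(e w).1}) :
    ∃ e' : H' ≃g G, (∀ v, e' (ι (some v)) = (e v).1) ∧ e' (ι none) = x := by
  let φ : Option X ≃ V := ((Equiv.optionSubtype x).symm e.toEquiv).1
  have hs : ∀ v, φ (some v) = (e v).1 := fun v => rfl
  have hn : φ none = x := ((Equiv.optionSubtype x).symm e.toEquiv).2
  have key : ∀ v, G.Adj x (e v).1 ↔ v = w := by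
    intro v
    rw [← mem_nb, hx, Finset.mem_singleton, ← Subtype.ext_iff, e.injective.eq_iff]
  have hadj : ∀ a b, G.Adj (φ a) (φ b) ↔ H'.Adj (ι a) (ι b) := by
    rintro (_ | a) (_ | b)
    · simp
    · rw [hn, hs, hι, key]
    · rw [hn, hs, G.adj_comm, H'.adj_comm, hι, key]
    · rw [hs, hs, hH]
      exact e.map_adj_iff
  refine ⟨⟨ι.symm.trans φ, ?_⟩, ?_, ?_⟩
  · intro a b
    simp [hadj]
  · intro v
    simp [← hs]
  · simp [hn]

/-- The vertices of `WGraph` with one more pendent vertex. -/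
def optionLeafEquiv (α β : Type) : Option (Unit ⊕ Fin 4 ⊕ α ⊕ (β × Fin 2)) ≃
    Unit ⊕ Fin 4 ⊕ Option α ⊕ (β × Fin 2) where
  toFun
    | none => Sum.inr (Sum.inr (Sum.inl none))
    | some (Sum.inl u) => Sum.inl u
    | some (Sum.inr (Sum.inl i)) => Sum.inr (Sum.inl i)
    | some (Sum.inr (Sum.inr (Sum.inl a))) => Sum.inr (Sum.inr (Sum.inl (some a)))
    | some (Sum.inr (Sum.inr (Sum.inr p))) => Sum.inr (Sum.inr (Sum.inr p))
  invFun
    | Sum.inl u => some (Sum.inl u)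
    | Sum.inr (Sum.inl i) => some (Sum.inr (Sum.inl i))
    | Sum.inr (Sum.inr (Sum.inl none)) => none
    | Sum.inr (Sum.inr (Sum.inl (some a))) => some (Sum.inr (Sum.inr (Sum.inl a)))
    | Sum.inr (Sum.inr (Sum.inr p)) => some (Sum.inr (Sum.inr (Sum.inr p)))
  left_inv := by rintro (_ | _ | _ | _ | _) <;> rfl
  right_inv := by rintro (_ | _ | (_ | _) | _) <;> rfl

/-- The vertices of `WGraph` with one more pendent path. -/
def optionPathEquiv (α β : Type) : Option (Option (Unit ⊕ Fin 4 ⊕ α ⊕ (β × Fin 2))) ≃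
    Unit ⊕ Fin 4 ⊕ α ⊕ (Option β × Fin 2) where
  toFun
    | none => Sum.inr (Sum.inr (Sum.inr (none, 1)))
    | some none => Sum.inr (Sum.inr (Sum.inr (none, 0)))
    | some (some (Sum.inl u)) => Sum.inl u
    | some (some (Sum.inr (Sum.inl i))) => Sum.inr (Sum.inl i)
    | some (some (Sum.inr (Sum.inr (Sum.inl a)))) => Sum.inr (Sum.inr (Sum.inl a))
    | some (some (Sum.inr (Sum.inr (Sum.inr (b, i))))) => Sum.inr (Sum.inr (Sum.inr (some b, i)))
  invFun
    | Sum.inl u => some (some (Sum.inl u))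
    | Sum.inr (Sum.inl i) => some (some (Sum.inr (Sum.inl i)))
    | Sum.inr (Sum.inr (Sum.inl a)) => some (some (Sum.inr (Sum.inr (Sum.inl a))))
    | Sum.inr (Sum.inr (Sum.inr (none, 0))) => some none
    | Sum.inr (Sum.inr (Sum.inr (none, 1))) => none
    | Sum.inr (Sum.inr (Sum.inr (some b, i))) => some (some (Sum.inr (Sum.inr (Sum.inr (b, i)))))
  left_inv := by rintro (_ | _ | _ | _ | _ | _) <;> rfl
  right_inv := by
    rintro (_ | _ | _ | ⟨_ | _, i⟩)
    · rfl
    · rfl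
    · rfl
    · fin_cases i <;> rfl
    · rfl

lemma WGraph_of_leaf {V : Type*} [Fintype V] {G : SimpleGraph V} {x : V} {α β : Type}
    (e : WGraph α β ≃g del G x) (hx : nb G x = {(e (Sum.inl ())).1}) :
    Nonempty (WGraph (Option α) β ≃g G) := by
  have h1 : ∀ u v, (WGraph (Option α) β).Adj (optionLeafEquiv α β (some u))
      (optionLeafEquiv α β (some v)) ↔ (WGraph α β).Adj u v := by
    rintro (u | u | u | u) (v | v | v | v) <;> simp [WGraph_adj, optionLeafEquiv, WRel]
  have h2 : ∀ v, (WGraph (Option α) β).Adj (optionLeafEquiv α β none)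
      (optionLeafEquiv α β (some v)) ↔ v = Sum.inl () := by
    rintro (v | v | v | v) <;> simp [WGraph_adj, optionLeafEquiv, WRel]
  obtain ⟨e', -⟩ := exists_iso_of_leaf _ h1 h2 e hx
  exact ⟨e'⟩

lemma WGraph_of_path {V : Type*} [Fintype V] {G : SimpleGraph V} {x : V} {y : {v : V // v ≠ x}}
    {α β : Type} (e : WGraph α β ≃g del (del G x) y) (hx : nb G x = {y.1})
    (hy : nb (del G x) y = {(e (Sum.inl ())).1}) :
    Nonempty (WGraph α (Option β) ≃g G) := by
  set H := (WGraph α (Option β)).comap fun v => optionPathEquiv α β (some v) with hH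
  have h1 : ∀ u v, H.Adj (Equiv.refl _ (some u)) (Equiv.refl _ (some v)) ↔
      (WGraph α β).Adj u v := by
    rintro (u | u | u | ⟨u, i⟩) (v | v | v | ⟨v, j⟩) <;>
      simp [hH, WGraph_adj, optionPathEquiv, WRel]
  have h2 : ∀ v, H.Adj (Equiv.refl _ none) (Equiv.refl _ (some v)) ↔ v = Sum.inl () := by
    rintro (v | v | v | ⟨v, i⟩) <;> simp [hH, WGraph_adj, optionPathEquiv, WRel]
  have h3 : ∀ v, (WGraph α (Option β)).Adj (optionPathEquiv α β none)
      (optionPathEquiv α β (some v)) ↔ v = none := by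
    rintro (_ | v | v | v | ⟨v, i⟩) <;> simp [WGraph_adj, optionPathEquiv, WRel]
  obtain ⟨e₁, -, h⟩ := exists_iso_of_leaf _ h1 h2 e hy
  obtain ⟨e', -⟩ := exists_iso_of_leaf (H := H) _ (fun _ _ => Iff.rfl) h3 e₁
    (by rw [hx, ← h]; rfl)
  exact ⟨e'⟩

lemma WGraph_congr {α β α' β' : Type} (e : α ≃ α') (e' : β ≃ β') :
    Nonempty (WGraph α β ≃g WGraph α' β') := by
  refine ⟨⟨Equiv.sumCongr (Equiv.refl _) (Equiv.sumCongr (Equiv.refl _)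
    (Equiv.sumCongr e (Equiv.prodCongr e' (Equiv.refl _)))), ?_⟩⟩
  rintro (u | u | u | ⟨u, i⟩) (v | v | v | ⟨v, j⟩) <;> simp [WGraph_adj, WRel]

lemma BnmGraph_iso (n m : ℕ) :
    Nonempty (BnmGraph n m ≃g WGraph (Fin (n - 2 * m + 1)) (Fin (m - 3))) := by
  refine ⟨⟨Equiv.refl _, ?_⟩⟩
  rintro (u | u | u | ⟨u, i⟩) (v | v | v | ⟨v, j⟩) <;> rfl

/-- `G` has the shape of the extremal graph on `2 * m + r` vertices with matching number `m`. -/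
def IsExtremal {V : Type*} (G : SimpleGraph V) (r m : ℕ) : Prop :=
  ∃ (α β : Type) (_ : Fintype α) (_ : Fintype β), Fintype.card α = r + 1 ∧
    Fintype.card β + 3 = m ∧ Nonempty (WGraph α β ≃g G)

/-- The vertices that are not leaves. -/
noncomputable def core {V : Type*} [Fintype V] (G : SimpleGraph V) : Finset V :=
  Finset.univ.filter fun v => 2 ≤ degR G v

lemma mem_core {V : Type*} [Fintype V] {G : SimpleGraph V} {v : V} :
    v ∈ core G ↔ 2 ≤ degR G v := by
  simp [core]

lemma card_leafNb_le {V : Type*} [Fintype V] (G : SimpleGraph V) (v : V) :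
    (leafNb G v).card ≤ degR G v := by
  rw [degR_eq_card]
  exact Finset.card_filter_le _ _

lemma sum_nb_swap {V : Type*} [Fintype V] (G : SimpleGraph V) (F : V → V → ℝ) :
    ∑ u, ∑ v ∈ nb G u, F u v = ∑ u, ∑ v ∈ nb G u, F v u := by
  refine Finset.sum_comm' fun x y => ?_
  simp [mem_nb, G.adj_comm]

/-- A discharging bound: an edge at a leaf is charged to its other end, and any other edge is split
according to the potential `b` of the degrees. -/
lemma two_mul_sum_core_le {V : Type*} [Fintype V] {G : SimpleGraph V} (b : ℕ → ℝ)
    (hb : ∀ u v, G.Adj u v → u ∈ core G → v ∈ core G →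
      b (degR G u) + b (degR G v) ≤ edgeWt (degR G u + degR G v))
    (hpos : ∀ v, 1 ≤ degR G v) :
    2 * ∑ u ∈ core G, (((degR G u : ℝ) - (leafNb G u).card) * b (degR G u) +
      (leafNb G u).card * edgeWt (degR G u + 1)) ≤ dartSum G := by
  set F : V → V → ℝ := fun u v => if u ∈ core G then
    (if degR G v = 1 then edgeWt (degR G u + 1) else b (degR G u)) else 0 with hF
  have hinner : ∀ u, ∑ v ∈ nb G u, F u v = if u ∈ core G then
      ((degR G u : ℝ) - (leafNb G u).card) * b (degR G u) +
      (leafNb G u).card * edgeWt (degR G u + 1) else 0 := by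
    intro u
    by_cases hu : u ∈ core G
    · have hc := Finset.card_filter_add_card_filter_not (s := nb G u) (fun v => degR G v = 1)
      have hc' : (degR G u : ℝ) = (leafNb G u).card +
          ((nb G u).filter fun v => ¬ degR G v = 1).card := by
        rw [degR_eq_card, ← hc]; push_cast; rfl
      simp only [hF, hu, if_true, Finset.sum_ite, Finset.sum_const, nsmul_eq_mul]
      rw [hc']
      simp only [leafNb]
      ring
    · simp [hF, hu]
  have h2 : 2 * ∑ u ∈ core G, (((degR G u : ℝ) - (leafNb G u).card) * b (degR G u) +
      (leafNb G u).card * edgeWt (degR G u + 1)) = ∑ u, ∑ v ∈ nb G u, (F u v + F v u) := by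
    simp only [Finset.sum_add_distrib]
    rw [← sum_nb_swap G F, ← two_mul, Finset.sum_congr rfl fun u _ => hinner u]
    simp [Finset.sum_add_distrib]
  rw [h2, dartSum]
  refine Finset.sum_le_sum fun u _ => Finset.sum_le_sum fun v hv => ?_
  have hu1 := hpos u
  have hv1 := hpos v
  by_cases hu : u ∈ core G <;> by_cases hv' : v ∈ core G
  · have := hb u v (mem_nb.1 hv) hu hv'
    have hu2 := mem_core.1 hu
    have hv2 := mem_core.1 hv'
    simp only [hF, hu, hv', if_true]
    rwa [if_neg (by omega), if_neg (by omega)]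
  · have : degR G v = 1 := by rw [mem_core] at hv'; omega
    simp [hF, hu, hv', this]
  · have : degR G u = 1 := by rw [mem_core] at hu; omega
    simp [hF, hu, hv', this, add_comm]
  · simpa [hF, hu, hv'] using (edgeWt_pos (by omega)).le

lemma core_nb_subset {V : Type*} [Fintype V] {G : SimpleGraph V} (hpos : ∀ v, 1 ≤ degR G v)
    (v : V) : ((nb G v).filter fun u => ¬ degR G u = 1) ⊆ (core G).erase v := by
  intro u hu
  rw [Finset.mem_filter, mem_nb] at hu
  have := hpos u
  exact Finset.mem_erase.2 ⟨hu.1.ne', mem_core.2 (by omega)⟩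

lemma degR_lt_add_card_core {V : Type*} [Fintype V] {G : SimpleGraph V}
    (hpos : ∀ v, 1 ≤ degR G v) {v : V} (hv : v ∈ core G) :
    degR G v < (leafNb G v).card + (core G).card := by
  have hc := Finset.card_filter_add_card_filter_not (s := nb G v) (fun v => degR G v = 1)
  have h := Finset.card_le_card (core_nb_subset hpos v)
  have h' := Finset.card_erase_add_one hv
  rw [← degR_eq_card] at hc
  simp only [leafNb]
  omega

lemma core_adj_of_degR {V : Type*} [Fintype V] {G : SimpleGraph V} (hpos : ∀ v, 1 ≤ degR G v)
    {u v : V} (hv : v ∈ core G) (h : (leafNb G v).card + (core G).card ≤ degR G v + 1)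
    (hu : u ∈ core G) (huv : u ≠ v) : G.Adj v u := by
  have hc := Finset.card_filter_add_card_filter_not (s := nb G v) (fun v => degR G v = 1)
  have h' := Finset.card_erase_add_one hv
  rw [← degR_eq_card] at hc
  simp only [leafNb] at h
  have heq := Finset.eq_of_subset_of_card_le (core_nb_subset hpos v) (by omega)
  have : u ∈ (core G).erase v := Finset.mem_erase.2 ⟨huv, hu⟩
  rw [← heq, Finset.mem_filter, mem_nb] at this
  exact this.1

lemma iso_of_injective_hom {V W : Type*} [Fintype V] [Fintype W] {G : SimpleGraph V}
    {H : SimpleGraph W} (φ : V → W) (hφ : Function.Injective φ)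
    (hc : Fintype.card W ≤ Fintype.card V) (hhom : ∀ u v, G.Adj u v → H.Adj (φ u) (φ v))
    (hdeg : ∀ v, degR H (φ v) ≤ degR G v) : Nonempty (G ≃g H) := by
  have hbij : Function.Bijective φ :=
    (Fintype.bijective_iff_injective_and_card φ).2 ⟨hφ,
      (Fintype.card_le_of_injective φ hφ).antisymm hc⟩
  refine ⟨⟨Equiv.ofBijective φ hbij, ?_⟩⟩
  intro u v
  refine ⟨fun h => ?_, hhom u v⟩
  have hsub : (nb G u).image φ ⊆ nb H (φ u) := by
    intro w hw
    obtain ⟨v, hv, rfl⟩ := Finset.mem_image.1 hw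
    exact mem_nb.2 (hhom u v (mem_nb.1 hv))
  have heq := Finset.eq_of_subset_of_card_le hsub (by
    rw [Finset.card_image_of_injective _ hφ, ← degR_eq_card, ← degR_eq_card]
    exact hdeg u)
  have : φ v ∈ (nb G u).image φ := by rw [heq]; exact mem_nb.2 h
  obtain ⟨w, hw, hwv⟩ := Finset.mem_image.1 this
  rw [hφ hwv] at hw
  exact mem_nb.1 hw

lemma extremal_le_of_card {r m n : ℕ} (hm : 1 ≤ m) (hn : n = 2 * m + r) (h4 : 4 ≤ n) :
    (m ≠ 3 → n ≤ 7 → extremal r m ≤ 2.0957 + 0.28 * (n - 4)) ∧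
    (m = 3 → extremal r m ≤ 2.9202 + 0.28 * (n - 6)) ∧
    (8 ≤ n → extremal r m ≤ 3.7232 + 0.395 * (n - 8)) := by
  have h8 : 8 ≤ n → (8 : ℝ) ≤ n := fun h => by exact_mod_cast h
  obtain rfl | rfl | rfl | hm4 : m = 1 ∨ m = 2 ∨ m = 3 ∨ 4 ≤ m := by omega
  · obtain ⟨r, rfl⟩ : ∃ r', r = 2 + r' := ⟨r - 2, by omega⟩
    have h := extremal_one_le r
    have hr : (n : ℝ) = 4 + r := by rw [hn]; push_cast; ring
    exact ⟨fun _ _ => by linarith, by omega, fun h' => by linarith [h8 h']⟩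
  · have h := extremal_two_le r
    have hr : (n : ℝ) = 4 + r := by rw [hn]; push_cast; ring
    exact ⟨fun _ _ => by linarith, by omega, fun h' => by linarith [h8 h']⟩
  · have h := extremal_three_le r
    have hr : (n : ℝ) = 6 + r := by rw [hn]; push_cast; ring
    exact ⟨by omega, fun _ => by linarith, fun h' => by linarith [h8 h']⟩
  · have h := extremal_le_of_four_le hm4 r
    have hr : (n : ℝ) = 2 * m + r := by rw [hn]; push_cast; ring
    refine ⟨by omega, by omega, fun h' => ?_⟩
    have : (4 : ℝ) ≤ m := by exact_mod_cast hm4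
    have : (0 : ℝ) ≤ r := by positivity
    linarith

/-- A graph with minimum degree at least one whose leaves are all matched and are attached to
vertices of degree at least three. -/
structure LeafMatched {V : Type*} [Fintype V] (G : SimpleGraph V) (f : V → V) : Prop where
  invol : ∀ v, f (f v) = v
  pos : ∀ v, 1 ≤ degR G v
  nb_leaf : ∀ x, degR G x = 1 → nb G x = {f x}
  three_le : ∀ x, degR G x = 1 → 3 ≤ degR G (f x)
  sum_degR : ∑ v, degR G v = 2 * Fintype.card V + 2

lemma LeafMatched.leafNb_subset {V : Type*} [Fintype V] {G : SimpleGraph V} {f : V → V}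
    (hG : LeafMatched G f) (v : V) :
    leafNb G v ⊆ {f v} := by
  intro x hx
  rw [leafNb, Finset.mem_filter, mem_nb] at hx
  have h : v ∈ nb G x := mem_nb.2 hx.1.symm
  rw [hG.nb_leaf x hx.2, Finset.mem_singleton] at h
  rw [Finset.mem_singleton, h, hG.invol]

lemma LeafMatched.sum_core {V : Type*} [Fintype V] {G : SimpleGraph V} {f : V → V}
    (hG : LeafMatched G f) :
    ∑ v ∈ core G, (leafNb G v).card + (core G).card = Fintype.card V ∧
    ∑ v ∈ core G, degR G v + ∑ v ∈ core G, (leafNb G v).card =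
      2 * Fintype.card V + 2 := by
  rw [← hG.sum_degR]
  have hcl : ∀ v, ¬ 2 ≤ degR G v ↔ degR G v = 1 := fun v => by have := hG.pos v; omega
  have h1 : (Finset.univ.filter fun v => ¬ 2 ≤ degR G v).card =
      ∑ v ∈ core G, (leafNb G v).card := by
    rw [Finset.card_eq_sum_card_fiberwise (f := f) (t := core G)]
    · refine Finset.sum_congr rfl fun v _ => ?_
      congr 1
      ext x
      simp only [hcl, Finset.mem_filter, Finset.mem_univ, true_and, leafNb, mem_nb]
      constructor
      · rintro ⟨h, rfl⟩
        have : f x ∈ nb G x := by rw [hG.nb_leaf x h, Finset.mem_singleton]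
        exact ⟨(mem_nb.1 this).symm, h⟩
      · rintro ⟨h, hx⟩
        have : v ∈ nb G x := mem_nb.2 h.symm
        rw [hG.nb_leaf x hx, Finset.mem_singleton] at this
        exact ⟨hx, this.symm⟩
    · intro x hx
      simp only [hcl, Finset.coe_filter, Finset.mem_univ, true_and, Set.mem_ofPred_eq] at hx
      have := hG.three_le x hx
      exact Finset.mem_coe.2 (mem_core.2 (by omega))
  have h2 := Finset.card_filter_add_card_filter_not (s := (Finset.univ : Finset V))
    (fun v => 2 ≤ degR G v)
  rw [Finset.card_univ] at h2
  have h4 := Finset.sum_filter_add_sum_filter_not (Finset.univ : Finset V)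
    (fun v => 2 ≤ degR G v) (degR G)
  rw [Finset.sum_congr (g := fun _ => 1) rfl
    (fun v hv => (hcl v).1 (Finset.mem_filter.1 hv).2)] at h4
  rw [Finset.sum_const, smul_eq_mul, mul_one] at h4
  rw [← h1]
  exact ⟨by rw [add_comm]; exact h2, h4⟩

lemma LeafMatched.two_add_le {V : Type*} [Fintype V] {G : SimpleGraph V} {f : V → V}
    (h : LeafMatched G f) {v : V} (hv : v ∈ core G) : 2 + (leafNb G v).card ≤ degR G v := by
  have h1 := Finset.card_le_card (h.leafNb_subset v)
  rw [Finset.card_singleton] at h1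
  rcases Nat.eq_zero_or_pos (leafNb G v).card with h0 | h0
  · rw [h0]; exact mem_core.1 hv
  · obtain ⟨x, hx⟩ := Finset.card_pos.1 h0
    have hxv := h.leafNb_subset v hx
    rw [Finset.mem_singleton] at hxv
    have := h.three_le x (Finset.mem_filter.1 hx).2
    rw [hxv, h.invol] at this
    omega

lemma LeafMatched.linear_le {V : Type*} [Fintype V] {G : SimpleGraph V} {f : V → V}
    (hG : LeafMatched G f) (b : ℕ → ℝ) (A B C : ℝ) (φ : V → ℝ)
    (hb : ∀ u v, G.Adj u v → u ∈ core G → v ∈ core G →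
      b (degR G u) + b (degR G v) ≤ edgeWt (degR G u + degR G v))
    (hW : ∀ v ∈ core G, A + B * (leafNb G v).card + C * (degR G v - (leafNb G v).card - 2) + φ v ≤
      ((degR G v : ℝ) - (leafNb G v).card) * b (degR G v) +
      (leafNb G v).card * edgeWt (degR G v + 1)) :
    2 * (A * (core G).card + B * (Fintype.card V - (core G).card) + 2 * C + ∑ v ∈ core G, φ v) ≤
      dartSum G := by
  refine le_trans ?_ (two_mul_sum_core_le b hb hG.pos)
  obtain ⟨h1, h2⟩ := hG.sum_core
  have h1' : (∑ v ∈ core G, ((leafNb G v).card : ℝ)) + (core G).card = Fintype.card V := by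
    exact_mod_cast h1
  have h2' : (∑ v ∈ core G, (degR G v : ℝ)) + ∑ v ∈ core G, ((leafNb G v).card : ℝ) =
      2 * Fintype.card V + 2 := by exact_mod_cast h2
  have h := Finset.sum_le_sum hW
  simp only [Finset.sum_add_distrib, ← Finset.mul_sum, Finset.sum_sub_distrib, Finset.sum_const,
    nsmul_eq_mul] at h ⊢
  rw [← eq_sub_iff_add_eq] at h1' h2'
  rw [h2', h1'] at h
  linarith

lemma LeafMatched.card_leafNb_le_one {V : Type*} [Fintype V] {G : SimpleGraph V} {f : V → V}
    (hG : LeafMatched G f) (v : V) : (leafNb G v).card ≤ 1 := by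
  simpa using Finset.card_le_card (hG.leafNb_subset v)

lemma LeafMatched.card_core {V : Type*} [Fintype V] {G : SimpleGraph V} {f : V → V}
    (hG : LeafMatched G f) :
    Fintype.card V ≤ 2 * (core G).card ∧ (core G).card ≤ Fintype.card V := by
  have h1 := hG.sum_core.1
  have h2 := Finset.sum_le_card_nsmul (core G) (fun v => (leafNb G v).card) 1
    fun v _ => hG.card_leafNb_le_one v
  simp only [smul_eq_mul, mul_one] at h2
  omega

lemma LeafMatched.sum_excess {V : Type*} [Fintype V] {G : SimpleGraph V} {f : V → V}
    (hG : LeafMatched G f) : ∑ v ∈ core G, (degR G v - (leafNb G v).card - 2) = 2 := by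
  obtain ⟨h1, h2⟩ := hG.sum_core
  have h3 : ∑ v ∈ core G, (degR G v - (leafNb G v).card - 2) +
      ∑ v ∈ core G, (leafNb G v).card + ∑ v ∈ core G, 2 = ∑ v ∈ core G, degR G v := by
    rw [← Finset.sum_add_distrib, ← Finset.sum_add_distrib]
    refine Finset.sum_congr rfl fun v hv => ?_
    have := hG.two_add_le hv
    omega
  rw [Finset.sum_const, smul_eq_mul] at h3
  omega

/-- The potential used when no vertex has more than three neighbours that are not leaves. -/
noncomputable def flatPotential (d : ℕ) : ℝ :=
  if d = 2 then 0.23812 else if d = 3 then 0.2041 else 0.17008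

lemma flatPotential_add_le {d e : ℕ} (hd : 2 ≤ d) (hd' : d ≤ 4) (he : 2 ≤ e) (he' : e ≤ 4) :
    flatPotential d + flatPotential e ≤ edgeWt (d + e) := by
  obtain ⟨h3, h5, h6, h7, h8, h9⟩ := edgeWt_bounds
  have h4 := edgeWt_four
  interval_cases d <;> interval_cases e <;> norm_num [flatPotential] <;> linarith

lemma flat_weight_le {d p : ℕ} (hd : 2 + p ≤ d) (hd' : d ≤ p + 3) (hp : p ≤ 1) :
    (0.4762 + 0.4319 * p + 0.0493 * (d - p - 2) + (if p = 0 ∧ d = 3 then 0.0867 else 0) ≤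
      ((d : ℝ) - p) * flatPotential d + p * edgeWt (d + 1)) ∧
    ((0.4762 : ℝ) + 0.345 * p + 0.1361 * (d - p - 2) + 0 ≤
      ((d : ℝ) - p) * flatPotential d + p * edgeWt (d + 1)) := by
  obtain ⟨h3, h5, h6, h7, h8, h9⟩ := edgeWt_bounds
  have h4 := edgeWt_four
  interval_cases p <;> interval_cases d <;> norm_num [flatPotential] <;> constructor <;> linarith

/-- The potential used when some vertex has four neighbours that are not leaves. -/
noncomputable def hubPotential (d : ℕ) : ℝ :=
  if d = 2 then 0.2431 else if d = 3 then 0.2041 else if d = 4 then 0.1651 else 0.1348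

lemma hubPotential_add_le {d e : ℕ} (hd : 2 ≤ d) (hd' : d ≤ 5) (he : 2 ≤ e) (he' : e ≤ 3) :
    hubPotential d + hubPotential e ≤ edgeWt (d + e) := by
  obtain ⟨h3, h5, h6, h7, h8, h9⟩ := edgeWt_bounds
  have h4 := edgeWt_four
  interval_cases d <;> interval_cases e <;> norm_num [hubPotential] <;> linarith

lemma hub_weight_le {p : ℕ} (hp : p ≤ 1) :
    ((0.4862 : ℝ) + 0.422 * p ≤ 2 * hubPotential (p + 2) + p * edgeWt (p + 3)) ∧
    ((0.66 : ℝ) + 0.287 * p ≤ 4 * hubPotential (p + 4) + p * edgeWt (p + 5)) := by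
  obtain ⟨h3, h5, h6, h7, h8, h9⟩ := edgeWt_bounds
  have h4 := edgeWt_four
  interval_cases p <;> norm_num [hubPotential]
  constructor <;> linarith

lemma LeafMatched.false_of_six {V : Type*} [Fintype V] {G : SimpleGraph V} {f : V → V}
    (hG : LeafMatched G f) (hmove : ∀ v, G.Adj v (f v)) (hV : Fintype.card V = 6)
    (hcore : (core G).card = 4)
    (h : ∀ v ∈ core G, degR G v = 2 + 2 * (leafNb G v).card) : False := by
  set A := (core G).filter fun v => (leafNb G v).card = 1 with hA
  have hmemA : ∀ {v}, v ∈ A ↔ v ∈ core G ∧ (leafNb G v).card = 1 := Finset.mem_filter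
  have hdeg : ∀ v ∈ core G, v ∉ A → degR G v = 2 := by
    intro v hv hvA
    have h1 : (leafNb G v).card ≠ 1 := fun h' => hvA (hmemA.2 ⟨hv, h'⟩)
    have h2 := hG.card_leafNb_le_one v
    have h3 := h v hv
    omega
  have hleaf : ∀ v ∈ A, degR G (f v) = 1 := by
    intro v hv
    obtain ⟨x, hx⟩ := Finset.card_pos.1 (by rw [(hmemA.1 hv).2]; norm_num)
    have := hG.leafNb_subset v hx
    rw [Finset.mem_singleton] at this
    rw [← this]
    exact (Finset.mem_filter.1 hx).2
  have hA2 : A.card + 4 = 6 := by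
    rw [← hV, ← hcore, ← hG.sum_core.1, hA, Finset.card_filter]
    congr 1
    refine Finset.sum_congr rfl fun v _ => ?_
    have := hG.card_leafNb_le_one v
    split_ifs <;> omega
  replace hA2 : A.card = 2 := by omega
  have hA4 : ∀ v ∈ A, degR G v = 4 := by
    intro v hv
    rw [h v (hmemA.1 hv).1, (hmemA.1 hv).2]
  obtain ⟨a, b, hab, hAeq⟩ := Finset.card_eq_two.1 hA2
  have ha : a ∈ A := by simp [hAeq]
  have hb : b ∈ A := by simp [hAeq]
  obtain ⟨c, hc⟩ : ((core G) \ A).Nonempty := by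
    rw [← Finset.card_pos, Finset.card_sdiff_of_subset (Finset.filter_subset _ _), hcore, hA2]
    norm_num
  rw [Finset.mem_sdiff] at hc
  have hadj : ∀ v ∈ A, G.Adj c v := by
    intro v hv
    refine (core_adj_of_degR hG.pos (hmemA.1 hv).1 ?_ hc.1 ?_).symm
    · rw [(hmemA.1 hv).2, hcore, hA4 v hv]
    · rintro rfl; exact hc.2 hv
  have hfc : ∀ v ∈ A, f c ≠ v := by
    rintro v hv rfl
    have := hleaf _ hv
    rw [hG.invol] at this
    have := mem_core.1 hc.1
    omega
  have hsub : {a, b, f c} ⊆ nb G c := by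
    intro v hv
    simp only [Finset.mem_insert, Finset.mem_singleton] at hv
    rcases hv with rfl | rfl | rfl
    · exact mem_nb.2 (hadj _ ha)
    · exact mem_nb.2 (hadj _ hb)
    · exact mem_nb.2 (hmove c)
  have h3 := Finset.card_le_card hsub
  rw [← degR_eq_card, hdeg c hc.1 hc.2, Finset.card_eq_three.2
    ⟨a, b, f c, hab, (hfc a ha).symm, (hfc b hb).symm, rfl⟩] at h3
  omega

lemma IsMatch.adj_of_card {V : Type*} [Fintype V] {G : SimpleGraph V} {f : V → V}
    (hf : IsMatch G f (Fintype.card V)) (v : V) : G.Adj v (f v) := by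
  refine hf.adj v ?_
  have h := Finset.eq_univ_of_card _ ((Finset.card_le_univ _).antisymm hf.le_card)
  have hv := Finset.mem_univ v
  rw [← h] at hv
  exact (Finset.mem_filter.1 hv).2

lemma LeafMatched.lt_of_flat {V : Type*} [Fintype V] {G : SimpleGraph V} {f : V → V} {r m : ℕ}
    (hG : LeafMatched G f) (hf : IsMatch G f (2 * m)) (hm : 1 ≤ m)
    (hV : Fintype.card V = 2 * m + r)
    (hflat : ∀ v ∈ core G, degR G v ≤ (leafNb G v).card + 3) :
    2 * extremal r m < dartSum G := by
  have hb : ∀ u v, G.Adj u v → u ∈ core G → v ∈ core G →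
      flatPotential (degR G u) + flatPotential (degR G v) ≤ edgeWt (degR G u + degR G v) := by
    intro u v _ hu hv
    have h1 := hG.card_leafNb_le_one u
    have h2 := hG.card_leafNb_le_one v
    have h3 := hflat u hu
    have h4 := hflat v hv
    exact flatPotential_add_le (mem_core.1 hu) (by omega) (mem_core.1 hv) (by omega)
  have hW := fun v hv => flat_weight_le (hG.two_add_le (v := v) hv) (hflat v hv)
    (hG.card_leafNb_le_one v)
  have b1 := hG.linear_le _ _ _ _ _ hb fun v hv => (hW v hv).1
  have b2 := hG.linear_le _ _ _ _ _ hb fun v hv => (hW v hv).2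
  rw [Finset.sum_const_zero, add_zero] at b2
  have hφ : ∀ v ∈ core G, (0 : ℝ) ≤
      if (leafNb G v).card = 0 ∧ degR G v = 3 then 0.0867 else 0 := by
    intro v _; split_ifs <;> norm_num
  have hnn := Finset.sum_nonneg hφ
  have h4 : 4 ≤ (core G).card := by
    obtain ⟨v, hv, hne⟩ := Finset.exists_ne_zero_of_sum_ne_zero
      (by rw [hG.sum_excess]; norm_num)
    have := degR_lt_add_card_core hG.pos hv
    omega
  obtain ⟨c1, c2⟩ := hG.card_core
  generalize hn : Fintype.card V = n at *
  obtain ⟨e1, e2, e3⟩ := extremal_le_of_card hm hV (by omega)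
  generalize hh : (core G).card = h at *
  have c1' : (n : ℝ) ≤ 2 * h := by exact_mod_cast c1
  have c2' : (h : ℝ) ≤ n := by exact_mod_cast c2
  have h4' : (4 : ℝ) ≤ h := by exact_mod_cast h4
  rcases le_or_gt 8 n with h8 | h8
  · have h8' : (8 : ℝ) ≤ n := by exact_mod_cast h8
    linarith [e3 h8]
  · by_cases hm3 : m = 3
    · have h6 : 6 ≤ n := by omega
      have := e2 hm3
      by_cases hh4 : h = 4 ∧ n = 6
      · obtain ⟨rfl, rfl⟩ := hh4
        have hmove := IsMatch.adj_of_card (G := G) (f := f) (by rw [hn]; rwa [hm3] at hf)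
        obtain ⟨a, ha, ha'⟩ : ∃ a ∈ core G, (leafNb G a).card = 0 ∧ degR G a = 3 := by
          by_contra! hcon
          have hle : ∀ v ∈ core G, degR G v - (leafNb G v).card - 2 ≤ (leafNb G v).card := by
            intro v hv
            have h3 := hflat v hv
            have h4 := hcon v hv
            omega
          have hsum := hG.sum_core.1
          have heq := (Finset.sum_eq_sum_iff_of_le hle).1 (by
            rw [hG.sum_excess]; omega)
          refine hG.false_of_six hmove hn hh fun v hv => ?_
          have h2 := hG.two_add_le hv
          have h3 := heq v hv
          omega
        have := Finset.single_le_sum hφ ha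
        rw [if_pos ha'] at this
        push_cast at *
        linarith
      · have hh5 : 5 ≤ h ∨ 7 ≤ n := by omega
        interval_cases n <;> interval_cases h <;> first | omega | (push_cast at *; linarith)
    · have := e1 hm3 (by omega)
      have : 4 ≤ n := by omega
      interval_cases n <;> interval_cases h <;> first | omega | (push_cast at *; linarith)

lemma LeafMatched.degR_eq_of_ne_hub {V : Type*} [Fintype V] {G : SimpleGraph V} {f : V → V}
    (hG : LeafMatched G f) {c : V} (hc : c ∈ core G) (hd : (leafNb G c).card + 4 ≤ degR G c) :
    degR G c = (leafNb G c).card + 4 ∧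
      ∀ v ∈ core G, v ≠ c → degR G v = (leafNb G v).card + 2 := by
  have hsum := hG.sum_excess
  rw [← Finset.add_sum_erase _ _ hc] at hsum
  refine ⟨by omega, fun v hv hvc => ?_⟩
  have h1 := Finset.single_le_sum (f := fun v => degR G v - (leafNb G v).card - 2)
    (fun _ _ => Nat.zero_le _) (Finset.mem_erase.2 ⟨hvc, hv⟩)
  have h2 := hG.two_add_le hv
  omega

lemma LeafMatched.degR_eq_two_of_hub {V : Type*} [Fintype V] {G : SimpleGraph V} {f : V → V}
    (hG : LeafMatched G f) (hV : Fintype.card V = 6) {c : V}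
    (hc : c ∈ core G) (hcore : (core G).card = 5) (hleaf : (leafNb G c).card = 1)
    (hd : degR G c = 5) {v : V} (hv : v ∈ core G) (hvc : v ≠ c) :
    (leafNb G v).card = 0 ∧ degR G v = 2 := by
  have h1 := (hG.degR_eq_of_ne_hub hc (by omega)).2 v hv hvc
  have h2 := hG.sum_core.1
  rw [← Finset.add_sum_erase _ _ hc] at h2
  have h3 := Finset.single_le_sum (f := fun v => (leafNb G v).card)
    (fun _ _ => Nat.zero_le _) (Finset.mem_erase.2 ⟨hvc, hv⟩)
  omega

lemma LeafMatched.extremal_le_of_hub {V : Type*} [Fintype V] {G : SimpleGraph V} {f : V → V}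
    (hG : LeafMatched G f) (hV : Fintype.card V = 6) {c : V}
    (hc : c ∈ core G) (hcore : (core G).card = 5) (hleaf : (leafNb G c).card = 1)
    (hd : degR G c = 5) : 2 * extremal 0 3 ≤ dartSum G := by
  have h2 := fun v hv hvc => hG.degR_eq_two_of_hub (v := v) hV hc hcore hleaf hd hv hvc
  have hle := hG.linear_le (fun d => if d = 5 then edgeWt 7 - 1 / 4 else 1 / 4) (1 / 2) 0 0
    (fun v => if v = c then 4 * (edgeWt 7 - 1 / 4) + edgeWt 6 - 1 / 2 else 0) ?_ ?_
  · rw [Finset.sum_ite_eq', if_pos hc, hcore] at hle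
    rw [extremal_zero_three]
    push_cast at hle
    linarith
  · have h4 := edgeWt_four
    intro u v huv hu hv
    by_cases huc : u = c
    · subst huc
      rw [hd, (h2 v hv huv.ne').2]
      norm_num
    · by_cases hvc : v = c
      · subst hvc
        rw [hd, (h2 u hu huv.ne).2]
        norm_num
      · rw [(h2 u hu huc).2, (h2 v hv hvc).2]
        norm_num [h4]
  · intro v hv
    by_cases hvc : v = c
    · subst hvc
      rw [hd, hleaf]
      norm_num
    · rw [(h2 v hv hvc).1, (h2 v hv hvc).2, if_neg hvc]
      norm_num

lemma LeafMatched.isExtremal_of_hub {V : Type*} [Fintype V] {G : SimpleGraph V} {f : V → V}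
    (hG : LeafMatched G f) (hmove : ∀ v, G.Adj v (f v)) (hV : Fintype.card V = 6) {c : V}
    (hc : c ∈ core G) (hcore : (core G).card = 5) (hleaf : (leafNb G c).card = 1)
    (hd : degR G c = 5) : IsExtremal G 0 3 := by
  obtain ⟨x, hx⟩ := Finset.card_pos.1 (by rw [hleaf]; norm_num)
  obtain rfl : x = f c := Finset.mem_singleton.1 (hG.leafNb_subset c hx)
  have hx1 : degR G (f c) = 1 := (Finset.mem_filter.1 hx).2
  have hxc : f c ∉ core G := by rw [mem_core]; omega
  have hdv : ∀ v ∈ core G, v ≠ c → degR G v = 2 := fun v hv hvc =>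
    (hG.degR_eq_two_of_hub hV hc hcore hleaf hd hv hvc).2
  have hout : ∀ v, v ∉ core G → v = f c := by
    obtain ⟨w, hw⟩ : ∃ w, Finset.univ \ core G = {w} := by
      rw [← Finset.card_eq_one, Finset.card_univ_sdiff, hV, hcore]
    have h : ∀ v, v ∉ core G → v = w := fun v hv => by
      rw [← Finset.mem_singleton, ← hw]
      simpa using hv
    exact fun v hv => by rw [h v hv, h _ hxc]
  have hadj : ∀ v, v ≠ c → G.Adj c v := by
    intro v hv
    by_cases hvc : v ∈ core G
    · exact core_adj_of_degR hG.pos hc (by omega) hvc hv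
    · rw [hout v hvc]; exact hmove c
  have hfcore : ∀ v ∈ core G, v ≠ c → f v ∈ core G ∧ f v ≠ c := by
    refine fun v hv hvc => ⟨?_, ?_⟩
    · by_contra hfv
      exact hvc (by rw [← hG.invol v, hout _ hfv, hG.invol])
    · rintro rfl
      rw [hG.invol] at hxc
      exact hxc hv
  obtain ⟨a, ha⟩ : ((core G).erase c).Nonempty := by
    rw [← Finset.card_pos, Finset.card_erase_of_mem hc]; omega
  obtain ⟨b, hb⟩ : (((core G).erase c) \ {a, f a}).Nonempty := by
    rw [← Finset.card_pos]
    have h1 := Finset.le_card_sdiff {a, f a} ((core G).erase c)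
    have h2 : ({a, f a} : Finset V).card ≤ 2 := Finset.card_le_two
    rw [Finset.card_erase_of_mem hc] at h1
    omega
  simp only [Finset.mem_sdiff, Finset.mem_erase, Finset.mem_insert, Finset.mem_singleton,
    not_or] at ha hb
  obtain ⟨⟨hbc, hb⟩, hba, hbfa⟩ := hb
  obtain ⟨hac, ha⟩ := ha
  obtain ⟨hfa, hfac⟩ := hfcore a ha hac
  obtain ⟨hfb, hfbc⟩ := hfcore b hb hbc
  set φ : Unit ⊕ Fin 4 ⊕ Unit ⊕ (Empty × Fin 2) → V := Sum.elim (fun _ => c)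
    (Sum.elim ![a, f a, b, f b] (Sum.elim (fun _ => f c) fun p => p.1.elim)) with hφ
  have hne : ∀ v, v ≠ f v := fun v => (hmove v).ne
  have hfab : f a ≠ f b := fun h => hba (by rw [← hG.invol b, ← h, hG.invol])
  have hafb : a ≠ f b := fun h => hbfa (by rw [h, hG.invol])
  have hmem : ∀ v ∈ core G, v ≠ f c := by rintro v hv rfl; exact hxc hv
  refine ⟨Unit, Empty, inferInstance, inferInstance, rfl, rfl, iso_of_injective_hom φ ?_ ?_ ?_ ?_⟩
  · have h1 := hmem c hc
    have h2 := hmem a ha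
    have h3 := hmem b hb
    have h4 := hmem _ hfa
    have h5 := hmem _ hfb
    have h6 := hne a
    have h7 := hne b
    rintro (⟨⟩ | i | ⟨⟩ | ⟨⟨⟩, _⟩) (⟨⟩ | j | ⟨⟩ | ⟨⟨⟩, _⟩) h <;> try fin_cases i
    all_goals try fin_cases j
    all_goals first | rfl | (exfalso; simp [hφ] at h; grind)
  · rw [hV]; simp
  · have hrel : ∀ u v, u ≠ v → WRel Unit Empty u v → G.Adj (φ u) (φ v) := by
      rintro (⟨⟩ | i | ⟨⟩ | ⟨⟨⟩, _⟩) (⟨⟩ | j | ⟨⟩ | ⟨⟨⟩, _⟩) huv h <;> try exact h.elim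
      · fin_cases j
        exacts [hadj a hac, hadj _ hfac, hadj b hbc, hadj _ hfbc]
      · exact hmove c
      · rcases h with ⟨rfl, rfl⟩ | ⟨rfl, rfl⟩
        exacts [hmove a, hmove b]
    intro u v huv
    obtain ⟨hne, h | h⟩ := WGraph_adj.1 huv
    · exact hrel u v hne h
    · exact (hrel v u hne.symm h).symm
  · rintro (⟨⟩ | i | ⟨⟩ | ⟨⟨⟩, _⟩)
    · rw [degR_WGraph_center]
      simp [hφ, hd]
    · rw [degR_WGraph_triangle]
      fin_cases i
      exacts [(hdv a ha hac).le, (hdv _ hfa hfac).le, (hdv b hb hbc).le, (hdv _ hfb hfbc).le]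
    · rw [degR_WGraph_leaf]
      exact hx1.le

lemma LeafMatched.le_of_hub {V : Type*} [Fintype V] {G : SimpleGraph V} {f : V → V} {r m : ℕ}
    (hG : LeafMatched G f) (hf : IsMatch G f (2 * m)) (hm : 1 ≤ m)
    (hV : Fintype.card V = 2 * m + r) {c : V} (hc : c ∈ core G)
    (hd : (leafNb G c).card + 4 ≤ degR G c) :
    2 * extremal r m ≤ dartSum G ∧ (dartSum G = 2 * extremal r m → IsExtremal G r m) := by
  obtain ⟨hdc, hdv⟩ := hG.degR_eq_of_ne_hub hc hd
  have hp := hG.card_leafNb_le_one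
  have hb : ∀ u v, G.Adj u v → u ∈ core G → v ∈ core G →
      hubPotential (degR G u) + hubPotential (degR G v) ≤ edgeWt (degR G u + degR G v) := by
    intro u v huv hu hv
    have h1 := hp u
    have h2 := hp v
    have hle : ∀ w ∈ core G, degR G w ≤ 5 := by
      intro w hw
      have := hp w
      by_cases hwc : w = c
      · rw [hwc] at this ⊢; omega
      · have := hdv w hw hwc; omega
    by_cases hvc : v = c
    · have h3 := hdv u hu (hvc ▸ huv.ne)
      rw [add_comm, add_comm (degR G u)]
      exact hubPotential_add_le (mem_core.1 hv) (hle v hv) (mem_core.1 hu) (by omega)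
    · have h3 := hdv v hv hvc
      exact hubPotential_add_le (mem_core.1 hu) (hle u hu) (mem_core.1 hv) (by omega)
  have b1 := hG.linear_le hubPotential 0.4862 0.422 0
    (fun v => if v = c then 0.1738 - 0.135 * ((leafNb G c).card : ℝ) else 0) hb (by
      intro v hv
      have h := hub_weight_le (hp v)
      by_cases hvc : v = c
      · subst hvc
        rw [if_pos rfl, hdc]
        push_cast
        linarith [h.2]
      · rw [if_neg hvc, hdv v hv hvc]
        push_cast
        linarith [h.1])
  rw [Finset.sum_ite_eq', if_pos hc] at b1
  have h5 := degR_lt_add_card_core hG.pos hc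
  replace h5 : 5 ≤ (core G).card := by omega
  obtain ⟨c1, c2⟩ := hG.card_core
  have hℓ : (leafNb G c).card + (core G).card ≤ Fintype.card V := by
    have h1 := Finset.single_le_sum (f := fun v => (leafNb G v).card)
      (fun _ _ => Nat.zero_le _) hc
    have h2 := hG.sum_core.1
    omega
  have hpc := hp c
  by_cases hex : m = 3 ∧ Fintype.card V = 6 ∧ (leafNb G c).card = 1
  · obtain ⟨rfl, h6, hp1⟩ := hex
    obtain rfl : r = 0 := by omega
    have hcore : (core G).card = 5 := by omega
    have h5 : degR G c = 5 := by omega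
    exact ⟨hG.extremal_le_of_hub h6 hc hcore hp1 h5, fun _ =>
      hG.isExtremal_of_hub (IsMatch.adj_of_card (by rwa [h6])) h6 hc hcore hp1 h5⟩
  · suffices h : 2 * extremal r m < dartSum G from ⟨h.le, fun h' => absurd h' h.ne'⟩
    clear hb hdv hp hf
    generalize hn : Fintype.card V = n at *
    obtain ⟨e1, e2, e3⟩ := extremal_le_of_card hm hV (by omega)
    generalize (core G).card = h at *
    generalize (leafNb G c).card = p at *
    have c1' : (n : ℝ) ≤ 2 * h := by exact_mod_cast c1
    have c2' : (p + h : ℝ) ≤ n := by exact_mod_cast hℓ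
    have h5' : (5 : ℝ) ≤ h := by exact_mod_cast h5
    have hp' : (p : ℝ) ≤ 1 := by exact_mod_cast hpc
    rcases le_or_gt 8 n with h8 | h8
    · have h8' : (8 : ℝ) ≤ n := by exact_mod_cast h8
      have := e3 h8
      rcases h5.eq_or_lt with rfl | h6
      · push_cast at *; linarith
      · have : (6 : ℝ) ≤ h := by exact_mod_cast h6
        linarith
    · have : 5 ≤ n := by omega
      by_cases hm3 : m = 3
      · have := e2 hm3
        interval_cases n <;> interval_cases h <;> interval_cases p <;>
          first | omega | (push_cast at *; linarith)
      · have := e1 hm3 (by omega)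
        interval_cases n <;> interval_cases h <;> interval_cases p <;>
          first | omega | (push_cast at *; linarith)

lemma card_del {V : Type*} [Fintype V] (x : V) :
    Fintype.card V = Fintype.card {v : V // v ≠ x} + 1 := by
  have := sum_eq_add_del x fun _ => (1 : ℕ)
  simp only [Finset.sum_const, smul_eq_mul, mul_one, Finset.card_univ] at this
  omega

lemma adj_iff_of_nb {V : Type*} [Fintype V] {G : SimpleGraph V} {x y : V} (hx : nb G x = {y})
    (v : V) : G.Adj x v ↔ v = y := by
  rw [← mem_nb, hx, Finset.mem_singleton]

lemma sum_degR_del {V : Type*} [Fintype V] {G : SimpleGraph V} {x y : V} (hx : nb G x = {y}) :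
    ∑ v, degR G v = ∑ v, degR (del G x) v + 2 := by
  have hy : G.Adj x y := (adj_iff_of_nb hx y).2 rfl
  have h : ∀ v : {v : V // v ≠ x},
      degR G v = degR (del G x) v + if v = ⟨y, hy.ne'⟩ then 1 else 0 := by
    intro v
    by_cases hv : v = ⟨y, hy.ne'⟩
    · subst hv
      rw [if_pos rfl]
      exact (degR_del_of_adj hy.symm).symm
    · rw [if_neg hv, add_zero]
      refine (degR_del_of_not_adj fun h => hv (Subtype.ext ?_)).symm
      exact (adj_iff_of_nb hx _).1 h.symm
  rw [sum_eq_add_del x, Finset.sum_congr rfl fun v _ => h v, Finset.sum_add_distrib,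
    Finset.sum_ite_eq', if_pos (Finset.mem_univ _), degR_eq_card, hx, Finset.card_singleton]
  omega

lemma degR_pos_of_connected {V : Type*} [Fintype V] {G : SimpleGraph V} (hG : G.Connected)
    (h : 2 ≤ Fintype.card V) (v : V) : 1 ≤ degR G v := by
  have := Fintype.one_lt_card_iff_nontrivial.1 h
  rw [degR_eq_degree]
  exact hG.preconnected.degree_pos_of_nontrivial v

lemma connected_del {V : Type*} [Fintype V] {G : SimpleGraph V} {x : V} (hG : G.Connected)
    (hx : degR G x = 1) : (del G x).Connected :=
  hG.induce_compl_singleton_of_degree_eq_one (by rwa [← degR_eq_degree])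

lemma two_le_degR_of_leaf {V : Type*} [Fintype V] {G : SimpleGraph V} {x y : V}
    (hG : G.Connected) (h : 3 ≤ Fintype.card V) (hx : nb G x = {y}) : 2 ≤ degR G y := by
  have hy : G.Adj x y := (adj_iff_of_nb hx y).2 rfl
  have hconn := connected_del hG (x := x) (by rw [degR_eq_card, hx, Finset.card_singleton])
  have := card_del x
  have h1 := degR_pos_of_connected hconn (by omega) ⟨y, hy.ne'⟩
  have h2 := degR_del_of_adj (v := ⟨y, hy.ne'⟩) hy.symm
  simp only at h2
  omega

/-- The lower bound for the sum-connectivity index together with its equality case. -/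
def Bound {V : Type*} [Fintype V] (G : SimpleGraph V) (r m : ℕ) : Prop :=
  2 * extremal r m ≤ dartSum G ∧ (dartSum G = 2 * extremal r m → IsExtremal G r m)

lemma bound_of_leaf {V : Type*} [Fintype V] {G : SimpleGraph V} {f : V → V} {x y : V} {r m : ℕ}
    (hG : G.Connected) (hV : Fintype.card V = 2 * m + (r + 1)) (hm : 1 ≤ m)
    (hsum : ∑ v, degR G v = 2 * Fintype.card V + 2) (hf : IsMatch G f (2 * m))
    (hx : nb G x = {y}) (ih : Bound (del G x) r m) : Bound G (r + 1) m := by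
  have hpos := degR_pos_of_connected hG (by omega)
  have hy2 := two_le_degR_of_leaf hG (by omega) hx
  have hp := hf.card_leafNb_add_le y
  have hd := hf.degR_bound y
  have hp1 : ((leafNb G y).card : ℝ) ≤ degR G y := by exact_mod_cast card_leafNb_le G y
  have hp2 : ((leafNb G y).card : ℝ) ≤ r + 2 := by
    have : (leafNb G y).card ≤ r + 2 := by omega
    exact_mod_cast this
  obtain ⟨g1, g2⟩ := leafGain_le (e := m + r + 3) hy2 hp1 hp2 (by omega)
  have hge := dartSum_leaf_ge hx hpos
  have hext := extremal_succ_left r m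
  refine ⟨by linarith [ih.1], fun heq => ?_⟩
  obtain ⟨α, β, _, _, hα, hβ, ⟨e⟩⟩ := ih.2 (by linarith [ih.1])
  replace g2 := g2 (by linarith [ih.1])
  have hy : G.Adj x y := (adj_iff_of_nb hx y).2 rfl
  have h2 := degR_del_of_adj (v := ⟨y, hy.ne'⟩) hy.symm
  have hc : e.symm ⟨y, hy.ne'⟩ = Sum.inl () := eq_center_of_degR (by
    rw [degR_iso e.symm]
    simp only at h2
    omega)
  refine ⟨Option α, β, inferInstance, inferInstance, by rw [Fintype.card_option, hα], hβ,
    WGraph_of_leaf e ?_⟩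
  rw [← hc, e.apply_symm_apply, hx]

lemma bound_of_path {V : Type*} [Fintype V] {G : SimpleGraph V} {f : V → V} {x : V}
    {y : {v : V // v ≠ x}} {z : {v : {v : V // v ≠ x} // v ≠ y}} {r m : ℕ}
    (hG : G.Connected) (hV : Fintype.card V = 2 * (m + 1) + r) (hm : 1 ≤ m)
    (hsum : ∑ v, degR G v = 2 * Fintype.card V + 2) (hf : IsMatch G f (2 * (m + 1)))
    (hx : nb G x = {y.1}) (hy : nb (del G x) y = {z.1})
    (ih : Bound (del (del G x) y) r m) : Bound G r (m + 1) := by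
  have hxy : G.Adj x y := (adj_iff_of_nb hx y).2 rfl
  have hyz : (del G x).Adj y z := (adj_iff_of_nb hy z).2 rfl
  have hxz : ¬ G.Adj z.1.1 x := fun h => z.2 (Subtype.ext ((adj_iff_of_nb hx _).1 h.symm))
  have hconn := connected_del hG (x := x) (by rw [degR_eq_card, hx, Finset.card_singleton])
  have hcard := card_del x
  have hpos := degR_pos_of_connected hconn (by omega)
  have hz2 := two_le_degR_of_leaf hconn (by omega) hy
  obtain ⟨f', hf', hfx, -⟩ := IsMatch.fix (k := 2 * m) hf x
  obtain ⟨g, hg, -⟩ := hf'.del_of_fixed hfx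
  have hp := hg.card_leafNb_add_le z
  have hd := hg.degR_bound z
  have hsum' := sum_degR_del hx
  have hp0 := card_leafNb_le (del G x) z
  have hp1 : ((leafNb (del G x) z).card : ℝ) - 1 ≤ degR (del G x) z - 1 := by
    have : ((leafNb (del G x) z).card : ℝ) ≤ degR (del G x) z := by exact_mod_cast hp0
    linarith
  have hp2 : ((leafNb (del G x) z).card : ℝ) - 1 ≤ r + 1 := by
    have : (leafNb (del G x) z).card ≤ r + 2 := by omega
    have : ((leafNb (del G x) z).card : ℝ) ≤ r + 2 := by exact_mod_cast this
    linarith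
  obtain ⟨g1, g2⟩ := pathGain_le (e := m + r + 3) hz2 hp1 hp2 (by omega)
  have hge : dartSum (del (del G x) y) +
      2 * leafGain (leafNb (del G x) z).card (degR (del G x) z) ≤ dartSum (del G x) := by
    convert dartSum_leaf_ge hy hpos
  have hyd : degR G y = 1 + 1 := by
    rw [← degR_del_of_adj hxy.symm, degR_eq_card, hy, Finset.card_singleton]
  have hnb : (nb G y).erase x = {z.1.1} := by
    ext v
    rw [Finset.mem_erase, mem_nb, Finset.mem_singleton]
    constructor
    · rintro ⟨h1, h2⟩
      exact congrArg Subtype.val ((adj_iff_of_nb hy ⟨v, h1⟩).1 h2)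
    · rintro rfl
      exact ⟨z.1.2, hyz⟩
  have heqn := dartSum_leaf hx hyd
  rw [hnb, Finset.sum_singleton, ← degR_del_of_not_adj hxz, show 1 + 2 = 3 from rfl,
    show 1 + 1 = 2 from rfl, add_comm 2, add_comm 1] at heqn
  have hext := extremal_succ_right r m
  have hpg : pathGain ((leafNb (del G x) z).card - 1) (degR (del G x) z) =
      leafGain (leafNb (del G x) z).card (degR (del G x) z) +
        (edgeWt (degR (del G x) z + 2) - edgeWt (degR (del G x) z + 1)) := by
    simp only [pathGain, leafGain, wtDiff]
    ring
  refine ⟨by linarith [ih.1], fun heq => ?_⟩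
  obtain ⟨α, β, _, _, hα, hβ, ⟨e⟩⟩ := ih.2 (by linarith [ih.1])
  replace g2 := g2 (by linarith [ih.1])
  have h2 := degR_del_of_adj (v := z) hyz.symm
  have hc : e.symm z = Sum.inl () := eq_center_of_degR (by
    rw [degR_iso e.symm]
    omega)
  refine ⟨α, Option β, inferInstance, inferInstance, hα, by rw [Fintype.card_option]; omega,
    WGraph_of_path e hx ?_⟩
  rw [← hc, e.apply_symm_apply, hy]

lemma LeafMatched.bound {V : Type*} [Fintype V] {G : SimpleGraph V} {f : V → V} {r m : ℕ}
    (hG : LeafMatched G f) (hf : IsMatch G f (2 * m)) (hm : 1 ≤ m)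
    (hV : Fintype.card V = 2 * m + r) : Bound G r m := by
  by_cases h : ∃ c ∈ core G, (leafNb G c).card + 4 ≤ degR G c
  · obtain ⟨c, hc, hd⟩ := h
    exact hG.le_of_hub hf hm hV hc hd
  · push Not at h
    have hlt := hG.lt_of_flat hf hm hV fun v hv => by have := h v hv; omega
    exact ⟨hlt.le, fun heq => absurd heq hlt.ne'⟩

lemma four_le_card {V : Type*} [Fintype V] {G : SimpleGraph V}
    (hsum : ∑ v, degR G v = 2 * Fintype.card V + 2) : 4 ≤ Fintype.card V := by
  have h : ∀ v ∈ Finset.univ, degR G v ≤ Fintype.card V - 1 := by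
    intro v _
    rw [degR_eq_card]
    have h1 := Finset.card_le_card (Finset.subset_univ (insert v (nb G v)))
    rw [Finset.card_insert_of_notMem (by simp [mem_nb]), Finset.card_univ] at h1
    omega
  have h1 := Finset.sum_le_card_nsmul _ _ _ h
  rw [hsum, Finset.card_univ, smul_eq_mul] at h1
  by_contra! hlt
  interval_cases Fintype.card V <;> omega

lemma isMatch_swap {V : Type*} [Fintype V] {G : SimpleGraph V} {y z : V} (h : G.Adj y z) :
    IsMatch G (Equiv.swap y z) 2 where
  invol v := by simp
  adj v hv := by
    rcases Equiv.swap_apply_ne_self_iff.1 hv with ⟨-, rfl | rfl⟩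
    · rwa [Equiv.swap_apply_left]
    · rw [Equiv.swap_apply_right]; exact h.symm
  le_card := by
    rw [← Finset.card_pair h.ne]
    refine Finset.card_le_card fun v hv => ?_
    rw [Finset.mem_filter]
    exact ⟨Finset.mem_univ _, Equiv.swap_apply_ne_self_iff.2 ⟨h.ne, by simpa using hv⟩⟩

lemma bound_of_isMatch.{u} (n : ℕ) : ∀ {V : Type u} [Fintype V] {G : SimpleGraph V} {f : V → V}
    {r m : ℕ}, Fintype.card V = n → G.Connected → Fintype.card V = 2 * m + r → 1 ≤ m →
    ∑ v, degR G v = 2 * Fintype.card V + 2 → IsMatch G f (2 * m) → Bound G r m := by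
  induction n using Nat.strong_induction_on with
  | h n ih =>
  intro V _ G f r m hn hG hV hm hsum hf
  have h4 := four_le_card hsum
  have hpos := degR_pos_of_connected hG (by omega)
  have step : ∀ {W : Type u} [Fintype W] {H : SimpleGraph W} {g : W → W} {x y : W} {s k : ℕ},
      Fintype.card W ≤ n → H.Connected → Fintype.card W = 2 * k + (s + 1) → 1 ≤ k →
      ∑ v, degR H v = 2 * Fintype.card W + 2 → IsMatch H g (2 * k) → g x = x → nb H x = {y} →
      Bound (del H x) s k := by
    intro W _ H g x y s k hn hH hW hk hsum hg hgx hx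
    obtain ⟨g', hg', -⟩ := hg.del_of_fixed hgx
    have hcard := card_del x
    have := sum_degR_del hx
    exact ih _ (by omega) rfl
      (connected_del hH (by rw [degR_eq_card, hx, Finset.card_singleton])) (by omega) hk
      (by omega) hg'
  by_cases hA : ∃ x g, degR G x = 1 ∧ IsMatch G g (2 * m) ∧ g x = x
  · obtain ⟨x, g, hx1, hg, hgx⟩ := hA
    obtain ⟨y, hx⟩ := exists_nb_eq hx1
    obtain ⟨g', hg', -⟩ := hg.del_of_fixed hgx
    have hcard := card_del x
    have hr : 2 * m ≤ Fintype.card {v // v ≠ x} := hg'.le_card.trans (Finset.card_le_univ _)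
    obtain ⟨r, rfl⟩ : ∃ r', r = r' + 1 := ⟨r - 1, by omega⟩
    exact bound_of_leaf hG hV hm hsum hg hx (step hn.le hG hV hm hsum hg hgx hx)
  push Not at hA
  have hleaf : ∀ x, degR G x = 1 → nb G x = {f x} := by
    intro x hx
    obtain ⟨y, hy⟩ := exists_nb_eq hx
    have := (adj_iff_of_nb hy _).1 (hf.adj x (hA x f hx hf))
    rwa [this]
  by_cases hB : ∃ x, degR G x = 1 ∧ degR G (f x) = 2
  · obtain ⟨x, hx1, hy2⟩ := hB
    have hx := hleaf x hx1
    have hxy : G.Adj x (f x) := (adj_iff_of_nb hx _).2 rfl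
    set y : {v : V // v ≠ x} := ⟨f x, hxy.ne'⟩ with hy
    have hy1 : degR (del G x) y = 1 := by
      have := degR_del_of_adj (v := y) hxy.symm
      simp only [hy] at this ⊢
      omega
    obtain ⟨z, hz⟩ := exists_nb_eq hy1
    have hyz : (del G x).Adj y z := (adj_iff_of_nb hz z).2 rfl
    obtain ⟨m, rfl⟩ : ∃ m', m = m' + 1 := ⟨m - 1, by omega⟩
    have hm1 : 1 ≤ m := by
      by_contra! h0
      obtain rfl : m = 0 := by omega
      refine hA x _ hx1 (isMatch_swap (G := G) (y := y) (z := z) hyz) ?_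
      exact Equiv.swap_apply_of_ne_of_ne hxy.ne z.2.symm
    obtain ⟨g, hg, hgx, hgy⟩ := IsMatch.fix (k := 2 * m) hf x
    obtain ⟨g₁, hg₁, hg₁'⟩ := hg.del_of_fixed hgx
    have h1 := sum_degR_del hx
    have c1 := card_del x
    have hb := step (s := r) (by omega) (connected_del hG hx1) (by omega) hm1 (by omega) hg₁
      (Subtype.ext (by rw [hg₁']; exact hgy)) hz
    refine bound_of_path (y := y) (z := ⟨z, hyz.ne'⟩) hG hV hm1 hsum hf hx hz ?_
    convert hb
  · push Not at hB
    refine LeafMatched.bound ⟨hf.invol, hpos, hleaf, fun x hx => ?_, hsum⟩ hf hm hV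
    have h1 := two_le_degR_of_leaf hG (by omega) (hleaf x hx)
    have h2 := hB x hx
    omega

lemma extremal_eq {n m : ℕ} (h : 2 * m ≤ n) :
    extremal (n - 2 * m) m = ((m : ℝ) + 1) / Real.sqrt ((n : ℝ) - (m : ℝ) + 4) +
      ((n : ℝ) - 2 * (m : ℝ) + 1) / Real.sqrt ((n : ℝ) - (m : ℝ) + 3) +
      ((m : ℝ) - 3) / Real.sqrt 3 + 1 := by
  obtain ⟨r, rfl⟩ := Nat.exists_eq_add_of_le h
  simp only [extremal, edgeWt, Nat.add_sub_cancel_left]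
  push_cast
  rw [show (2 * (m : ℝ) + r - m) = m + r by ring, show 2 * (m : ℝ) + r - 2 * m = r by ring]
  ring

lemma isExtremal_iff {V : Type*} [Fintype V] (G : SimpleGraph V) {n m : ℕ} (hm : 3 ≤ m) :
    IsExtremal G (n - 2 * m) m ↔ Nonempty (G ≃g BnmGraph n m) := by
  obtain ⟨e⟩ := BnmGraph_iso n m
  constructor
  · rintro ⟨α, β, _, _, hα, hβ, ⟨e'⟩⟩
    obtain ⟨e''⟩ := WGraph_congr (Fintype.equivFinOfCardEq hα)
      (Fintype.equivFinOfCardEq (α := β) (n := m - 3) (by omega))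
    exact ⟨(e'.symm.trans e'').trans e.symm⟩
  · rintro ⟨e'⟩
    exact ⟨_, _, inferInstance, inferInstance, Fintype.card_fin _,
      by rw [Fintype.card_fin]; omega, ⟨(e'.trans e).symm⟩⟩

lemma IsExtremal.dartSum_eq {V : Type*} [Fintype V] {G : SimpleGraph V} {r m : ℕ}
    (h : IsExtremal G r m) : dartSum G = 2 * extremal r m := by
  obtain ⟨α, β, _, _, hα, hβ, ⟨e⟩⟩ := h
  rw [dartSum_iso e, dartSum_WGraph hα hβ]

end Graph

/-- Let `G` be a bicyclic graph with `n` vertices and matching number `m`, where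
`3 ≤ m ≤ ⌊n/2⌋`. Then
`χ(G) ≥ (m+1)/√(n−m+4) + (n−2m+1)/√(n−m+3) + (m−3)/√3 + 1`, with equality if and
only if `G ≅ B_{n,m}`. -/
theorem stmt_6 {V : Type*} [Fintype V] (G : SimpleGraph V) (n m : ℕ)
    (hm : 3 ≤ m) (hmn : 2 * m ≤ n)
    (hcard : Fintype.card V = n) (hconn : G.Connected)
    (hedges : G.edgeSet.ncard = n + 1)
    (hmatch : matchingNumber G = m) :
    sumConn G ≥ ((m : ℝ) + 1) / Real.sqrt ((n : ℝ) - (m : ℝ) + 4) +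
        ((n : ℝ) - 2 * (m : ℝ) + 1) / Real.sqrt ((n : ℝ) - (m : ℝ) + 3) +
        ((m : ℝ) - 3) / Real.sqrt 3 + 1 ∧
    (sumConn G = ((m : ℝ) + 1) / Real.sqrt ((n : ℝ) - (m : ℝ) + 4) +
        ((n : ℝ) - 2 * (m : ℝ) + 1) / Real.sqrt ((n : ℝ) - (m : ℝ) + 3) +
        ((m : ℝ) - 3) / Real.sqrt 3 + 1 ↔
      Nonempty (G ≃g BnmGraph n m)) := by
  rw [← extremal_eq hmn, ← isExtremal_iff G hm]
  obtain ⟨f, hf⟩ := exists_isMatch G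
  rw [hmatch] at hf
  have hb : Bound G (n - 2 * m) m := bound_of_isMatch n hcard hconn (by omega) (by omega)
    (by rw [sum_degR, hedges, hcard]; ring) hf
  have h := dartSum_eq G
  exact ⟨by linarith [hb.1], fun heq => hb.2 (by linarith), fun hG => by
    linarith [hG.dartSum_eq]⟩
end

section
/- Let n ≥ 6 and let G be a bicyclic graph with n vertices and matching number 2. Then χ(G) ≥ 1/√(n+2) + (n−4)/√n + 2/√(n+1) + 2/√5, with equality if and only if G is isomorphic to B_n(n−1,3). -/
open SimpleGraph

/-- Vertex type of the graph `B_n(a,b)`. -/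
def BabVert (a b : ℕ) : Type := Fin 4 ⊕ Fin (a - 3) ⊕ Fin (b - 3)

instance (a b : ℕ) : Fintype (BabVert a b) := by unfold BabVert; infer_instance

def BabRel (a b : ℕ) : BabVert a b → BabVert a b → Prop
  | Sum.inl i, Sum.inl j =>
      (i = 0 ∧ j = 1) ∨ (i = 0 ∧ j = 2) ∨ (i = 0 ∧ j = 3) ∨ (i = 1 ∧ j = 2) ∨ (i = 1 ∧ j = 3)
  | Sum.inl i, Sum.inr (Sum.inl _) => i = 0
  | Sum.inl i, Sum.inr (Sum.inr _) => i = 1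
  | _, _ => False

/-- The graph `B_n(a,b)` (where `a + b = n + 2`): the unique 4-vertex bicyclic graph
(`K₄` minus the edge between vertices `2` and `3`), with `a - 3` pendent vertices
attached to the degree-three vertex `0` and `b - 3` pendent vertices attached to
the degree-three vertex `1`. -/
def BabGraph (a b : ℕ) : SimpleGraph (BabVert a b) := SimpleGraph.fromRel (BabRel a b)

/-- If `{u, v, w}` is a vertex cover, a sum over the edges splits into three star sums. -/
lemma sum_edgeSet_of_cover_three {V : Type*} [Fintype V] [DecidableEq V] (G : SimpleGraph V)
    [DecidableRel G.Adj] (F : Sym2 V → ℝ) {u v w : V} (huv : u ≠ v) (huw : u ≠ w) (hvw : v ≠ w)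
    (hcov : ∀ x y, G.Adj x y → x = u ∨ x = v ∨ x = w ∨ y = u ∨ y = v ∨ y = w) :
    ∑ e ∈ G.edgeSet.toFinite.toFinset, F e =
      ∑ x with G.Adj u x, F s(u, x) + ∑ x with G.Adj v x ∧ x ≠ u, F s(v, x) +
        ∑ x with G.Adj w x ∧ x ≠ u ∧ x ≠ v, F s(w, x) := by
  have hinj : ∀ a : V, Function.Injective (fun x => s(a, x)) := fun a x y h => by
    have := Sym2.eq_iff.1 h
    grind
  have hset : G.edgeSet.toFinite.toFinset =
      (({x | G.Adj u x} : Finset V).image (fun x => s(u, x)) ∪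
        ({x | G.Adj v x ∧ x ≠ u} : Finset V).image (fun x => s(v, x))) ∪
        ({x | G.Adj w x ∧ x ≠ u ∧ x ≠ v} : Finset V).image (fun x => s(w, x)) := by
    ext e
    induction e with | _ a b
    simp only [Set.Finite.mem_toFinset, mem_edgeSet, Finset.mem_union, Finset.mem_image,
      Finset.mem_filter, Finset.mem_univ, true_and, Sym2.eq_iff]
    constructor
    · intro h
      have h' := h.symm
      rcases hcov a b h with rfl | rfl | rfl | rfl | rfl | rfl <;> grind
    · rintro ((⟨x, hx, h⟩ | ⟨x, hx, h⟩) | ⟨x, hx, h⟩)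
      · rcases h with ⟨rfl, rfl⟩ | ⟨rfl, rfl⟩
        exacts [hx, hx.symm]
      · rcases h with ⟨rfl, rfl⟩ | ⟨rfl, rfl⟩
        exacts [hx.1, hx.1.symm]
      · rcases h with ⟨rfl, rfl⟩ | ⟨rfl, rfl⟩
        exacts [hx.1, hx.1.symm]
  rw [hset, Finset.sum_union, Finset.sum_union, Finset.sum_image (hinj u).injOn,
    Finset.sum_image (hinj v).injOn, Finset.sum_image (hinj w).injOn]
  · rw [Finset.disjoint_left]
    simp only [Finset.mem_image, Finset.mem_filter, Finset.mem_univ, true_and]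
    rintro _ ⟨x, hx, rfl⟩ ⟨y, hy, h⟩
    rw [Sym2.eq_iff] at h
    grind
  · rw [Finset.disjoint_left]
    simp only [Finset.mem_union, Finset.mem_image, Finset.mem_filter, Finset.mem_univ, true_and]
    rintro _ (⟨x, hx, rfl⟩ | ⟨x, hx, rfl⟩) ⟨y, hy, h⟩ <;>
    · rw [Sym2.eq_iff] at h
      grind

lemma sum_edgeSet_of_cover_two {V : Type*} [Fintype V] [DecidableEq V] (G : SimpleGraph V)
    [DecidableRel G.Adj] (F : Sym2 V → ℝ) {u v : V} (huv : u ≠ v) (hV : 2 < Fintype.card V)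
    (hcov : ∀ x y, G.Adj x y → x = u ∨ x = v ∨ y = u ∨ y = v) :
    ∑ e ∈ G.edgeSet.toFinite.toFinset, F e =
      ∑ x with G.Adj u x, F s(u, x) + ∑ x with G.Adj v x ∧ x ≠ u, F s(v, x) := by
  obtain ⟨w, hw⟩ := Finset.exists_mem_notMem_of_card_lt_card (s := {u, v}) (t := Finset.univ)
    ((Finset.card_le_two).trans_lt hV)
  simp only [Finset.mem_univ, Finset.mem_insert, Finset.mem_singleton, not_or, true_and] at hw
  rw [sum_edgeSet_of_cover_three G F huv (Ne.symm hw.1) (Ne.symm hw.2)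
    (fun x y h => by have := hcov x y h; tauto), add_eq_left]
  refine Finset.sum_eq_zero fun x hx => ?_
  simp only [Finset.mem_filter, Finset.mem_univ, true_and] at hx
  have := hcov w x hx.1
  grind

lemma degR_eq_card_filter {V : Type*} [Fintype V] (G : SimpleGraph V) [DecidableRel G.Adj] (v : V) :
    degR G v = ({x | G.Adj v x} : Finset V).card := by
  rw [degR, ← Set.ncard_coe_finset]
  congr 1
  ext x
  simp

lemma bddAbove_matching_sizes {V : Type*} [Fintype V] (G : SimpleGraph V) :
    BddAbove {k | ∃ M : Set (Sym2 V), M ⊆ G.edgeSet ∧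
      M.Pairwise (fun e f => ∀ v, v ∈ e → v ∉ f) ∧ M.ncard = k} := by
  refine ⟨Nat.card (Sym2 V), ?_⟩
  rintro _ ⟨M, -, -, rfl⟩
  exact Set.ncard_le_card M

/-- No three edges are pairwise disjoint. -/
def NoThreeMatching {V : Type*} (G : SimpleGraph V) : Prop :=
  ∀ ⦃a b c d e f : V⦄, G.Adj a b → G.Adj c d → G.Adj e f →
    a = c ∨ a = d ∨ b = c ∨ b = d ∨ a = e ∨ a = f ∨ b = e ∨ b = f ∨ c = e ∨ c = f ∨ d = e ∨ d = f

lemma noThreeMatching_of_matchingNumber {V : Type*} [Fintype V] {G : SimpleGraph V}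
    (hG : matchingNumber G = 2) : NoThreeMatching G := by
  intro a b c d e f hab hcd hef
  by_contra h
  simp only [not_or] at h
  have h3 : 3 ≤ matchingNumber G := by
    refine le_csSup (bddAbove_matching_sizes G) ⟨{s(a, b), s(c, d), s(e, f)}, ?_, ?_, ?_⟩
    · rintro x (rfl | rfl | rfl) <;> assumption
    · rintro x (rfl | rfl | rfl) y (rfl | rfl | rfl) hne v hx hy <;>
        simp only [Sym2.mem_iff] at hx hy <;> grind
    · rw [Set.ncard_eq_three]
      refine ⟨_, _, _, ?_, ?_, ?_, rfl⟩ <;> rw [Ne, Sym2.eq_iff] <;> grind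
  omega

lemma exists_disjoint_edges {V : Type*} [Fintype V] {G : SimpleGraph V}
    (hG : matchingNumber G = 2) :
    ∃ a b c d, G.Adj a b ∧ G.Adj c d ∧ a ≠ c ∧ a ≠ d ∧ b ≠ c ∧ b ≠ d := by
  have hmem : matchingNumber G ∈ {k | ∃ M : Set (Sym2 V), M ⊆ G.edgeSet ∧
      M.Pairwise (fun e f => ∀ v, v ∈ e → v ∉ f) ∧ M.ncard = k} :=
    Nat.sSup_mem ⟨0, ∅, by simp, by simp, by simp⟩ (bddAbove_matching_sizes G)
  rw [hG] at hmem
  obtain ⟨M, hM, hpair, hcard⟩ := hmem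
  obtain ⟨x, y, hxy, rfl⟩ := Set.ncard_eq_two.1 hcard
  induction x with | _ a b
  induction y with | _ c d
  have h := hpair (Set.mem_insert _ _) (Set.mem_insert_of_mem _ rfl) hxy
  refine ⟨a, b, c, d, hM (Set.mem_insert _ _),
    hM (Set.mem_insert_of_mem _ rfl), ?_⟩
  have h1 := h a (by simp)
  have h2 := h b (by simp)
  simp only [Sym2.mem_iff] at h1 h2
  tauto

lemma exists_adj_of_connected {V : Type*} [Fintype V] {G : SimpleGraph V} (hconn : G.Connected)
    (hV : 1 < Fintype.card V) (x : V) : ∃ y, G.Adj x y := by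
  obtain ⟨z, hz⟩ := Fintype.exists_ne_of_one_lt_card hV x
  obtain ⟨p⟩ := hconn.preconnected x z
  obtain ⟨d, -, hd, -⟩ := p.exists_boundary_dart {x} rfl hz
  exact ⟨d.snd, (show d.fst = x from hd) ▸ d.adj⟩

/-- `G` has a vertex cover of size two, or all its edges avoiding one vertex lie on three further
vertices. -/
def HasTightCover {V : Type*} (G : SimpleGraph V) : Prop :=
  (∃ u v, u ≠ v ∧ ∀ x y, G.Adj x y → x = u ∨ x = v ∨ y = u ∨ y = v) ∨
    ∃ s p q r, s ≠ p ∧ s ≠ q ∧ s ≠ r ∧ p ≠ q ∧ p ≠ r ∧ q ≠ r ∧ ∀ x y, G.Adj x y →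
      x = s ∨ y = s ∨ ((x = p ∨ x = q ∨ x = r) ∧ (y = p ∨ y = q ∨ y = r))

section TightCover

variable {V : Type*} {G : SimpleGraph V} {a b c d : V}

/-- `x` is none of the vertices `a, b, c, d`. -/
def Outside (a b c d x : V) : Prop := x ≠ a ∧ x ≠ b ∧ x ≠ c ∧ x ≠ d

/-- If outside the matching `ab, cd` only `a` and `c` have neighbours, the graph has a tight
cover. -/
lemma hasTightCover_of_outer_neighbors
    (no3 : NoThreeMatching G)
    (hdeg : ∀ x, ∃ y, G.Adj x y)
    (hV : ∀ x, ∃ y, y ≠ x ∧ Outside a b c d y)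
    (hab : G.Adj a b) (hcd : G.Adj c d) (hac : a ≠ c) (had : a ≠ d) (hbc : b ≠ c) (hbd : b ≠ d)
    (hb : ∀ x, Outside a b c d x → ¬ G.Adj b x) (hd : ∀ x, Outside a b c d x → ¬ G.Adj d x) :
    HasTightCover G := by
  have hI : ∀ x y, G.Adj x y → ¬ Outside a b c d x ∨ ¬ Outside a b c d y := fun x y h => by
    have := no3 hab hcd h
    have := h.ne; have := hab.ne; have := hcd.ne
    grind [Outside]
  have hne := hab.ne
  have hne' := hcd.ne
  by_cases h : G.Adj b d
  · have huniq : ∀ i, Outside a b c d i → ∀ j, Outside a b c d j → G.Adj a i →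
        G.Adj c j → i = j := by
      intro i hi j hj hai hcj
      have := no3 hai hcj h
      grind [Outside]
    by_cases hc : ∃ j, Outside a b c d j ∧ G.Adj c j
    · by_cases ha : ∃ i, Outside a b c d i ∧ G.Adj a i
      · obtain ⟨j, hj, hcj⟩ := hc
        obtain ⟨i, hi, hai⟩ := ha
        obtain ⟨k, hki, hk⟩ := hV i
        obtain ⟨l, hl⟩ := hdeg k
        have := hl.symm
        have := hI _ _ hl
        have := huniq i hi j hj hai hcj
        have := huniq i hi k hk hai
        have := huniq k hk j hj
        grind [Outside]
      · refine Or.inr ⟨c, d, a, b, hne', hac.symm, hbc.symm, had.symm, hbd.symm, hne, ?_⟩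
        intro x y hxy
        have := hxy.symm
        have := hI x y hxy
        grind [Outside]
    · refine Or.inr ⟨a, b, c, d, hne, hac, had, hbc, hbd, hne', ?_⟩
      intro x y hxy
      have := hxy.symm
      have := hI x y hxy
      grind [Outside]
  · refine Or.inl ⟨a, c, hac, fun x y hxy => ?_⟩
    have := hxy.symm
    have := hI x y hxy
    have := hxy.ne
    grind [Outside]

/-- If both ends of a matching edge have a common outer neighbour, the graph has a tight cover. -/
lemma hasTightCover_of_outer_triangle
    (no3 : NoThreeMatching G)
    (hconn : G.Connected) (hdeg : ∀ x, ∃ y, G.Adj x y)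
    (hV : ∀ x, ∃ y, y ≠ x ∧ Outside a b c d y)
    (hab : G.Adj a b) (hcd : G.Adj c d) (hac : a ≠ c) (had : a ≠ d) (hbc : b ≠ c) (hbd : b ≠ d)
    {i : V} (hi : Outside a b c d i) (hai : G.Adj a i) (hbi : G.Adj b i) :
    HasTightCover G := by
  have hne := hab.ne
  have hne' := hcd.ne
  have hI : ∀ x y, G.Adj x y → ¬ Outside a b c d x ∨ ¬ Outside a b c d y := fun x y h => by
    have := no3 hab hcd h
    have := h.ne
    grind [Outside]
  have hna : ∀ j, Outside a b c d j → G.Adj a j → j = i := fun j hj h => by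
    have := no3 h hbi hcd
    grind [Outside]
  have hnb : ∀ j, Outside a b c d j → G.Adj b j → j = i := fun j hj h => by
    have := no3 h hai hcd
    grind [Outside]
  obtain ⟨k, hki, hk⟩ := hV i
  have key : ∀ {c d : V}, G.Adj c d → a ≠ c → a ≠ d → b ≠ c → b ≠ d → i ≠ c → i ≠ d → k ≠ c →
      k ≠ d → G.Adj c k → (∀ x, Outside a b c d x → ¬ G.Adj d x) →
      (∀ x y, G.Adj x y → ¬ Outside a b c d x ∨ ¬ Outside a b c d y) →
      (∀ j, Outside a b c d j → G.Adj a j → j = i) →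
      (∀ j, Outside a b c d j → G.Adj b j → j = i) → HasTightCover G := by
    intro c d hcd hac had hbc hbd hic hid hkc hkd hck hd hI hna hnb
    have h1 : ¬ G.Adj a d := fun h => by
      have := no3 hbi h hck
      grind [Outside]
    have h2 : ¬ G.Adj b d := fun h => by
      have := no3 hai h hck
      grind [Outside]
    refine Or.inr ⟨c, a, b, i, hac.symm, hbc.symm, hic.symm, hne, hai.ne, hbi.ne, ?_⟩
    intro x y hxy
    have := hxy.symm
    have := hxy.ne
    have := hI x y hxy
    grind [Outside]
  obtain ⟨l, hl⟩ := hdeg k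
  have hk' : G.Adj c k ∨ G.Adj d k := by
    have := hl.symm
    have := hI _ _ hl
    grind [Outside]
  by_cases hdk : ∃ x, Outside a b c d x ∧ G.Adj d x
  · by_cases hck : ∃ x, Outside a b c d x ∧ G.Adj c x
    · exfalso
      obtain ⟨x, hx, hdx⟩ := hdk
      obtain ⟨y, hy, hcy⟩ := hck
      have huniq : ∀ x, Outside a b c d x → ∀ y, Outside a b c d y → G.Adj d x →
          G.Adj c y → x = y := by
        intro x hx y hy hdx hcy
        have := no3 hab hdx hcy
        grind [Outside]
      have hxk : x = k := by
        rcases hk' with h | h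
        · exact huniq x hx k hk hdx h
        · rw [huniq x hx y hy hdx hcy, huniq k hk y hy h hcy]
      have hyk : y = k := hxk ▸ (huniq x hx y hy hdx hcy).symm
      subst hxk hyk
      obtain ⟨p⟩ := hconn.preconnected a c
      obtain ⟨⟨⟨s, t⟩, hst⟩, -, hs, ht⟩ := 
        p.exists_boundary_dart {a, b, i} (by simp) (by grind [Outside])
      simp only [Set.mem_insert_iff, Set.mem_singleton_iff] at hs ht
      have hst' := hst.symm
      have := hI s t hst
      have := huniq i hi y hy
      have := huniq y hy i hi
      have hcross : t = c ∨ t = d := by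
        grind [Outside]
      rcases hs with rfl | rfl | rfl <;> rcases hcross with rfl | rfl
      · have := no3 hst hbi hdx
        grind [Outside]
      · have := no3 hst hbi hcy
        grind [Outside]
      · have := no3 hst hai hdx
        grind [Outside]
      · have := no3 hst hai hcy
        grind [Outside]
      · grind [Outside]
      · grind [Outside]
    · refine key hcd.symm had hac hbd hbc ?_ ?_ ?_ ?_ ?_ ?_ ?_ ?_ ?_ <;> grind [Outside]
  · refine key hcd hac had hbc hbd ?_ ?_ ?_ ?_ ?_ ?_ ?_ ?_ ?_ <;> grind [Outside]

end TightCover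

lemma hasTightCover_of_matchingNumber_eq_two {V : Type*} [Fintype V] {G : SimpleGraph V}
    (hconn : G.Connected) (hV : 6 ≤ Fintype.card V) (hG : matchingNumber G = 2) :
    HasTightCover G := by
  classical
  obtain ⟨a, b, c, d, hab, hcd, hac, had, hbc, hbd⟩ := exists_disjoint_edges hG
  have no3 := noThreeMatching_of_matchingNumber hG
  have hdeg := exists_adj_of_connected hconn (by omega)
  have hV' : ∀ x, ∃ y, y ≠ x ∧ Outside a b c d y := fun x => by
    obtain ⟨y, -, hy⟩ := Finset.exists_mem_notMem_of_card_lt_card (s := [x, a, b, c, d].toFinset)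
      (t := Finset.univ) ((List.toFinset_card_le _).trans_lt (Nat.lt_of_lt_of_le (by simp) hV))
    exact ⟨y, by simpa [Outside] using hy⟩
  have hne := hab.ne
  have hne' := hcd.ne
  have split : ∀ {a b c d : V}, G.Adj a b → G.Adj c d → a ≠ c → a ≠ d → b ≠ c → b ≠ d →
      (∃ i, Outside a b c d i ∧ G.Adj a i ∧ G.Adj b i) ∨ (∀ x, Outside a b c d x → ¬ G.Adj a x) ∨
        ∀ x, Outside a b c d x → ¬ G.Adj b x := by
    intro a b c d hab hcd hac had hbc hbd
    by_contra! h
    obtain ⟨h, ⟨x, hx, hax⟩, y, hy, hby⟩ := h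
    have := no3 hax hby hcd
    have := hab.ne
    have := hcd.ne
    grind [Outside]
  have perm : ∀ x, Outside c d a b x ↔ Outside a b c d x := fun x => by grind [Outside]
  have hs := split hcd hab hac.symm hbc.symm had.symm hbd.symm
  simp only [perm] at hs
  rcases split hab hcd hac had hbc hbd with ⟨i, hi, hai, hbi⟩ | h
  · exact hasTightCover_of_outer_triangle no3 hconn hdeg hV' hab hcd hac had hbc hbd hi hai hbi
  rcases hs with ⟨i, hi, hci, hdi⟩ | h'
  · exact hasTightCover_of_outer_triangle no3 hconn hdeg (by simpa only [perm] using hV') hcd hab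
      hac.symm hbc.symm had.symm hbd.symm ((perm i).2 hi) hci hdi
  have perm1 : ∀ x, Outside b a c d x ↔ Outside a b c d x := fun x => by grind [Outside]
  have perm2 : ∀ x, Outside a b d c x ↔ Outside a b c d x := fun x => by grind [Outside]
  have perm3 : ∀ x, Outside b a d c x ↔ Outside a b c d x := fun x => by grind [Outside]
  rcases h with h | h <;> rcases h' with h' | h'
  · refine hasTightCover_of_outer_neighbors no3 hdeg ?_ hab.symm hcd.symm hbd hbc had hac ?_ ?_ <;>
      simpa only [perm3]
  · refine hasTightCover_of_outer_neighbors no3 hdeg ?_ hab.symm hcd hbc hbd hac had ?_ ?_ <;>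
      simpa only [perm1]
  · refine hasTightCover_of_outer_neighbors no3 hdeg ?_ hab hcd.symm had hac hbd hbc ?_ ?_ <;>
      simpa only [perm2]
  · exact hasTightCover_of_outer_neighbors no3 hdeg hV' hab hcd hac had hbc hbd h h'

/-- The contribution of a cover vertex of degree `x` with `x - 3` pendent neighbours and `c`
neighbours of degree two. -/
noncomputable def starWeight (c x : ℝ) : ℝ := (x - 3) / √(x + 1) + c / √(x + 2)

lemma strictConcaveOn_starWeight {c : ℝ} (hc : c ≤ 4) :
    StrictConcaveOn ℝ (Set.Ioi (-1)) (starWeight c) := by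
  have hpow : ∀ (k r : ℝ) {x : ℝ}, 0 < x + k →
      HasDerivAt (fun y => (y + k) ^ r) (r * (x + k) ^ (r - 1)) x := fun k r x hx => by
    simpa using ((hasDerivAt_id x).add_const k).rpow_const (p := r) (Or.inl hx.ne')
  have heq : Set.EqOn (fun x : ℝ => (x + 1) ^ (1 / 2 : ℝ) - 4 * (x + 1) ^ (-1 / 2 : ℝ) +
      c * (x + 2) ^ (-1 / 2 : ℝ)) (starWeight c) (Set.Ioi (-1)) := by
    intro x hx
    have h1 : 0 < x + 1 := by linarith [Set.mem_Ioi.1 hx]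
    have h2 : 0 < x + 2 := by linarith
    have hs := Real.sqrt_pos.2 h1
    have hsq := Real.sq_sqrt h1.le
    simp only [starWeight, neg_div, Real.rpow_neg h1.le, Real.rpow_neg h2.le, ← Real.sqrt_eq_rpow]
    rw [div_eq_mul_inv c]
    congr 1
    field_simp
    linarith
  refine StrictConcaveOn.congr ?_ heq
  have h1 : ∀ x ∈ Set.Ioi (-1 : ℝ), HasDerivAt (fun x : ℝ => (x + 1) ^ (1 / 2 : ℝ) -
      4 * (x + 1) ^ (-1 / 2 : ℝ) + c * (x + 2) ^ (-1 / 2 : ℝ))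
      (1 / 2 * (x + 1) ^ (-1 / 2 : ℝ) + 2 * (x + 1) ^ (-3 / 2 : ℝ) -
        c / 2 * (x + 2) ^ (-3 / 2 : ℝ)) x := by
    intro x hx
    have h1 : 0 < x + 1 := by linarith [Set.mem_Ioi.1 hx]
    have h2 : 0 < x + 2 := by linarith
    refine (((hpow 1 (1 / 2) h1).sub ((hpow 1 (-1 / 2) h1).const_mul 4)).add
      ((hpow 2 (-1 / 2) h2).const_mul c)).congr_deriv ?_
    norm_num
    ring
  have h2 : ∀ x ∈ Set.Ioi (-1 : ℝ), HasDerivAt (fun x : ℝ => 1 / 2 * (x + 1) ^ (-1 / 2 : ℝ) +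
      2 * (x + 1) ^ (-3 / 2 : ℝ) - c / 2 * (x + 2) ^ (-3 / 2 : ℝ))
      (-1 / 4 * (x + 1) ^ (-3 / 2 : ℝ) - 3 * (x + 1) ^ (-5 / 2 : ℝ) +
        3 * c / 4 * (x + 2) ^ (-5 / 2 : ℝ)) x := by
    intro x hx
    have h1 : 0 < x + 1 := by linarith [Set.mem_Ioi.1 hx]
    have h2 : 0 < x + 2 := by linarith
    refine ((((hpow 1 (-1 / 2) h1).const_mul (1 / 2)).add
      ((hpow 1 (-3 / 2) h1).const_mul 2)).sub
      ((hpow 2 (-3 / 2) h2).const_mul (c / 2))).congr_deriv ?_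
    norm_num
    ring
  refine strictConcaveOn_of_deriv2_neg' (convex_Ioi _)
    (fun x hx => (h1 x hx).continuousAt.continuousWithinAt) fun x hx => ?_
  have hderiv : deriv^[2] (fun x : ℝ => (x + 1) ^ (1 / 2 : ℝ) -
      4 * (x + 1) ^ (-1 / 2 : ℝ) + c * (x + 2) ^ (-1 / 2 : ℝ)) x =
      -1 / 4 * (x + 1) ^ (-3 / 2 : ℝ) - 3 * (x + 1) ^ (-5 / 2 : ℝ) +
        3 * c / 4 * (x + 2) ^ (-5 / 2 : ℝ) :=
    ((h2 x hx).congr_of_eventuallyEq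
      (Filter.eventuallyEq_of_mem (Ioi_mem_nhds hx) fun y hy => (h1 y hy).deriv)).deriv
  rw [hderiv]
  have hx1 : 0 < x + 1 := by linarith [Set.mem_Ioi.1 hx]
  have hlt : (x + 2) ^ (-5 / 2 : ℝ) < (x + 1) ^ (-5 / 2 : ℝ) :=
    Real.rpow_lt_rpow_of_neg hx1 (by linarith) (by norm_num)
  have hp : 0 < (x + 1) ^ (-3 / 2 : ℝ) := Real.rpow_pos_of_pos hx1 _
  have hp' : 0 < (x + 2) ^ (-5 / 2 : ℝ) := Real.rpow_pos_of_pos (by linarith) _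
  nlinarith

lemma StrictConcaveOn.add_lt_add_of_add_eq {s : Set ℝ} {f : ℝ → ℝ} (hf : StrictConcaveOn ℝ s f)
    {p q a b : ℝ} (hp : p ∈ s) (hq : q ∈ s) (hpa : p < a) (hpb : p < b) (h : a + b = p + q) :
    f p + f q < f a + f b := by
  have hpq : 0 < q - p := by linarith
  have key : ∀ {a b : ℝ}, p < a → p < b → a + b = p + q →
      (b - p) / (q - p) * f p + (a - p) / (q - p) * f q < f a := by
    intro a b hpa hpb h
    have := hf.2 hp hq (by linarith) (div_pos (sub_pos.2 hpb) hpq) (div_pos (sub_pos.2 hpa) hpq)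
      (by rw [← add_div, div_eq_one_iff_eq hpq.ne']; linarith)
    have hmid : (b - p) / (q - p) * p + (a - p) / (q - p) * q = a := by
      obtain rfl : b = p + q - a := by linarith
      field_simp
      ring
    simpa only [smul_eq_mul, hmid] using this
  have h1 := key hpa hpb h
  have h2 := key hpb hpa (by linarith)
  have hsum : (b - p) / (q - p) + (a - p) / (q - p) = 1 := by
    rw [← add_div, div_eq_one_iff_eq hpq.ne']
    linarith
  linear_combination h1 + h2 - (f p + f q) * hsum

lemma starWeight_add_lt {c a b q : ℝ} (hc : c ≤ 4) (ha : 3 < a) (hb : 3 < b)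
    (h : a + b = 3 + q) : starWeight c 3 + starWeight c q < starWeight c a + starWeight c b :=
  (strictConcaveOn_starWeight hc).add_lt_add_of_add_eq (by norm_num [Set.mem_Ioi])
    (Set.mem_Ioi.2 (by linarith)) ha hb h

lemma starWeight_add_le {c a b q : ℝ} (hc : c ≤ 4) (ha : 3 ≤ a) (hb : 3 ≤ b)
    (h : a + b = 3 + q) : starWeight c 3 + starWeight c q ≤ starWeight c a + starWeight c b := by
  rcases ha.eq_or_lt with rfl | ha
  · obtain rfl : b = q := by linarith
    rfl
  rcases hb.eq_or_lt with rfl | hb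
  · obtain rfl : a = q := by linarith
    rw [add_comm]
  exact (starWeight_add_lt hc ha hb h).le

/-- The sum-connectivity index of `B_n(n - 1, 3)`. -/
noncomputable def minSumConn (n : ℕ) : ℝ :=
  1 / √((n : ℝ) + 2) + ((n : ℝ) - 4) / √(n : ℝ) + 2 / √((n : ℝ) + 1) + 2 / √5

lemma minSumConn_eq (n : ℕ) :
    minSumConn n = 1 / √((n : ℝ) + 2) + (starWeight 2 3 + starWeight 2 (n - 1)) := by
  have h1 : (n : ℝ) - 1 + 1 = n := by ring
  have h2 : (n : ℝ) - 1 + 2 = n + 1 := by ring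
  have h3 : (n : ℝ) - 1 - 3 = n - 4 := by ring
  have h4 : (3 : ℝ) + 2 = 5 := by norm_num
  simp only [minSumConn, starWeight, h1, h2, h3, h4, sub_self, zero_div]
  ring

lemma one_div_sqrt_lt {x y : ℝ} (hx : 0 < x) (h : x < y) : 1 / √y < 1 / √x :=
  one_div_lt_one_div_of_lt (Real.sqrt_pos.2 hx) (Real.sqrt_lt_sqrt hx.le h)

lemma minSumConn_lt_starWeight {n : ℕ} (hn : 6 ≤ n) :
    minSumConn n < starWeight 3 3 + starWeight 3 (n - 2) := by
  have hn' : (6 : ℝ) ≤ n := by exact_mod_cast hn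
  have h1 : (n : ℝ) - 2 + 1 = n - 1 := by ring
  have h2 : (n : ℝ) - 2 + 2 = n := by ring
  have h3 : (n : ℝ) - 2 - 3 = n - 5 := by ring
  have h4 : (3 : ℝ) + 2 = 5 := by norm_num
  simp only [minSumConn, starWeight, h1, h2, h3, h4, sub_self, zero_div]
  have e1 := one_div_sqrt_lt (show (0 : ℝ) < n - 1 by linarith) (show (n : ℝ) - 1 < n by linarith)
  have e2 := one_div_sqrt_lt (show (0 : ℝ) < n by linarith) (show (n : ℝ) < n + 1 by linarith)
  have e3 := one_div_sqrt_lt (show (0 : ℝ) < 5 by linarith) (show (5 : ℝ) < n + 2 by linarith)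
  have e4 := mul_lt_mul_of_pos_left e1 (show (0 : ℝ) < n - 5 by linarith)
  simp only [div_eq_mul_one_div (_ - _ : ℝ), div_eq_mul_one_div (2 : ℝ),
    div_eq_mul_one_div (3 : ℝ)]
  linarith

lemma minSumConn_lt_triangle {n : ℕ} (hn : 6 ≤ n) :
    minSumConn n <
      ((n : ℝ) - 4) / √((n : ℝ) - 1) + 2 / √((n : ℝ) + 1) + 2 / √5 + 1 / √6 := by
  have hn' : (6 : ℝ) ≤ n := by exact_mod_cast hn
  have e1 := one_div_sqrt_lt (show (0 : ℝ) < n - 1 by linarith) (show (n : ℝ) - 1 < n by linarith)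
  have e3 := one_div_sqrt_lt (show (0 : ℝ) < 6 by linarith) (show (6 : ℝ) < n + 2 by linarith)
  have e4 := mul_lt_mul_of_pos_left e1 (show (0 : ℝ) < n - 4 by linarith)
  rw [minSumConn]
  simp only [div_eq_mul_one_div (_ - _ : ℝ)]
  linarith

lemma degR_eq_card_s7 {V : Type*} {G : SimpleGraph V} {v : V} {S : Finset V}
    (h : ∀ x, G.Adj v x ↔ x ∈ S) : degR G v = S.card := by
  rw [degR, ← Set.ncard_coe_finset]
  congr 1
  ext x
  simp [h]

lemma sum_neighbors_split {V M : Type*} [Fintype V] [DecidableEq V] [AddCommMonoid M]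
    (G : SimpleGraph V) [DecidableRel G.Adj] (u v : V) (F : V → M) :
    ∑ x with G.Adj u x, F x = ∑ x with G.Adj u x ∧ x ≠ v ∧ ¬ G.Adj v x, F x +
      ∑ x with G.Adj u x ∧ G.Adj v x, F x + if G.Adj u v then F v else 0 := by
  have h : (if G.Adj u v then F v else 0) = ∑ x, if x = v then
      (if G.Adj u x then F x else 0) else 0 := by simp
  rw [h]
  simp only [Finset.sum_filter, ← Finset.sum_add_distrib]
  refine Finset.sum_congr rfl fun x _ => ?_
  have := G.loopless.irrefl v
  by_cases h1 : G.Adj u x <;> by_cases h2 : x = v <;> by_cases h3 : G.Adj v x <;> simp_all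

lemma sum_neighbors_ne_split {V M : Type*} [Fintype V] [DecidableEq V] [AddCommMonoid M]
    (G : SimpleGraph V) [DecidableRel G.Adj] (u v : V) (F : V → M) :
    ∑ x with G.Adj v x ∧ x ≠ u, F x = ∑ x with G.Adj v x ∧ x ≠ u ∧ ¬ G.Adj u x, F x +
      ∑ x with G.Adj u x ∧ G.Adj v x, F x := by
  simp only [Finset.sum_filter, ← Finset.sum_add_distrib]
  refine Finset.sum_congr rfl fun x _ => ?_
  have := G.loopless.irrefl u
  by_cases h1 : G.Adj u x <;> by_cases h2 : x = u <;> by_cases h3 : G.Adj v x <;> simp_all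

lemma sumConn_of_cover_two {V : Type*} [Fintype V] [DecidableEq V] {G : SimpleGraph V}
    [DecidableRel G.Adj] {n : ℕ} (hn : 6 ≤ n) (hcard : Fintype.card V = n)
    (hdeg : ∀ x, ∃ y, G.Adj x y) (hedges : G.edgeSet.ncard = n + 1) {u v : V} (huv : u ≠ v)
    (hcov : ∀ x y, G.Adj x y → x = u ∨ x = v ∨ y = u ∨ y = v) :
    3 ≤ degR G u ∧ 3 ≤ degR G v ∧
      ((G.Adj u v ∧ ({x | G.Adj u x ∧ G.Adj v x} : Finset V).card = 2 ∧
        degR G u + degR G v = n + 2 ∧ sumConn G = 1 / √((n : ℝ) + 2) +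
          (starWeight 2 (degR G u) + starWeight 2 (degR G v))) ∨
      (¬ G.Adj u v ∧ degR G u + degR G v = n + 1 ∧
        sumConn G = starWeight 3 (degR G u) + starWeight 3 (degR G v))) := by
  have hA : ∀ x ∈ ({x | G.Adj u x ∧ x ≠ v ∧ ¬ G.Adj v x} : Finset V), degR G x = 1 := by
    intro x hx
    simp only [Finset.mem_filter, Finset.mem_univ, true_and] at hx
    refine degR_eq_card_s7 (S := {u}) fun y => ?_
    have := hcov x y
    have := hx.1.symm
    have := hx.1.ne
    grind [SimpleGraph.adj_comm]
  have hB : ∀ x ∈ ({x | G.Adj v x ∧ x ≠ u ∧ ¬ G.Adj u x} : Finset V), degR G x = 1 := by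
    intro x hx
    simp only [Finset.mem_filter, Finset.mem_univ, true_and] at hx
    refine degR_eq_card_s7 (S := {v}) fun y => ?_
    have := hcov x y
    have := hx.1.symm
    have := hx.1.ne
    grind [SimpleGraph.adj_comm]
  have hC : ∀ x ∈ ({x | G.Adj u x ∧ G.Adj v x} : Finset V), degR G x = 2 := by
    intro x hx
    simp only [Finset.mem_filter, Finset.mem_univ, true_and] at hx
    rw [degR_eq_card_s7 (S := {u, v}), Finset.card_pair huv]
    intro y
    have := hcov x y
    have := hx.1.symm
    have := hx.2.symm
    have := hx.1.ne
    have := hx.2.ne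
    grind
  have hdu := sum_neighbors_split G u v (fun _ => 1)
  have hdv := sum_neighbors_split G v u (fun _ => 1)
  simp only [← Finset.card_eq_sum_ones, ← degR_eq_card_filter] at hdu hdv
  have hE := sum_edgeSet_of_cover_two G (fun _ => 1) huv (by omega) hcov
  rw [sum_neighbors_split G u v, sum_neighbors_ne_split G u v] at hE
  simp only [Finset.sum_const, nsmul_eq_mul, mul_one, ← Set.ncard_eq_toFinset_card, hedges] at hE
  have hS : sumConn G = _ := sum_edgeSet_of_cover_two G _ huv (by omega) hcov
  rw [sum_neighbors_split G u v, sum_neighbors_ne_split G u v] at hS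
  simp only [Sym2.lift_mk] at hS
  have hconst : ∀ (w : V) (S : Finset V) (k : ℕ), (∀ x ∈ S, degR G x = k) →
      ∑ x ∈ S, 1 / √((degR G w : ℝ) + degR G x) = S.card * (1 / √((degR G w : ℝ) + k)) :=
    fun w S k h => by
      rw [Finset.sum_congr rfl fun x hx => by rw [h x hx], Finset.sum_const, nsmul_eq_mul]
  rw [hconst u _ 1 hA, hconst u _ 2 hC, hconst v _ 1 hB, hconst v _ 2 hC] at hS
  have huniv : (Finset.univ : Finset V) = {u, v} ∪
      (({x | G.Adj u x ∧ x ≠ v ∧ ¬ G.Adj v x} : Finset V) ∪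
        (({x | G.Adj v x ∧ x ≠ u ∧ ¬ G.Adj u x} : Finset V) ∪
          ({x | G.Adj u x ∧ G.Adj v x} : Finset V))) := by
    ext x
    obtain ⟨y, hy⟩ := hdeg x
    have := hcov x y hy
    have := hy.symm
    simp only [Finset.mem_union, Finset.mem_filter, Finset.mem_univ, true_and,
      Finset.mem_insert, Finset.mem_singleton]
    grind
  have hn' := congrArg Finset.card huniv
  rw [Finset.card_union_of_disjoint, Finset.card_union_of_disjoint, Finset.card_union_of_disjoint,
    Finset.card_pair huv, Finset.card_univ, hcard] at hn'
  rotate_left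
  · rw [Finset.disjoint_left]; grind
  · rw [Finset.disjoint_left]; grind
  · rw [Finset.disjoint_left]; grind [SimpleGraph.irrefl]
  have hcomm : (Finset.univ.filter fun x => G.Adj v x ∧ G.Adj u x) =
      Finset.univ.filter fun x => G.Adj u x ∧ G.Adj v x := by
    simp only [and_comm]
  rw [hcomm] at hdv
  generalize ({x | G.Adj u x ∧ x ≠ v ∧ ¬ G.Adj v x} : Finset V).card = α at *
  generalize ({x | G.Adj v x ∧ x ≠ u ∧ ¬ G.Adj u x} : Finset V).card = β at *
  generalize ({x | G.Adj u x ∧ G.Adj v x} : Finset V).card = γ at *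
  have hcast : ∀ {k m : ℕ}, k = m + 3 → (m : ℝ) = k - 3 := fun h => by
    rw [h]; push_cast; ring
  by_cases h : G.Adj u v
  · simp only [h, h.symm, if_true] at hdu hdv hE hS
    have hE' : n + 1 = α + γ + 1 + (β + γ) := by exact_mod_cast hE
    obtain rfl : γ = 2 := by omega
    have h1 : degR G u + degR G v = n + 2 := by omega
    refine ⟨by omega, by omega, Or.inl ⟨h, rfl, h1, ?_⟩⟩
    have h2 : (degR G u : ℝ) + degR G v = n + 2 := by exact_mod_cast h1
    rw [hS, h2, hcast (show degR G u = α + 3 by omega), hcast (show degR G v = β + 3 by omega)]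
    simp only [starWeight]
    push_cast
    ring
  · have h' : ¬ G.Adj v u := fun h' => h h'.symm
    simp only [h, h', if_false] at hdu hdv hE hS
    have hE' : n + 1 = α + γ + 0 + (β + γ) := by exact_mod_cast hE
    obtain rfl : γ = 3 := by omega
    refine ⟨by omega, by omega, Or.inr ⟨h, by omega, ?_⟩⟩
    rw [hS, hcast (show degR G u = α + 3 by omega), hcast (show degR G v = β + 3 by omega)]
    simp only [starWeight]
    push_cast
    ring

lemma sumConn_of_triangle {V : Type*} [Fintype V] [DecidableEq V] {G : SimpleGraph V}
    {n : ℕ} (hcard : Fintype.card V = n) (hn : 6 ≤ n) {s p q r : V}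
    (hsp : s ≠ p) (hsq : s ≠ q) (hsr : s ≠ r) (hpq : G.Adj p q) (hpr : G.Adj p r)
    (hqr : G.Adj q r) (hs : ∀ x, G.Adj s x ↔ x ∉ ({s, r} : Finset V))
    (hcov : ∀ x y, G.Adj x y → x = s ∨ y = s ∨
      ((x = p ∨ x = q ∨ x = r) ∧ (y = p ∨ y = q ∨ y = r))) :
    sumConn G = ((n : ℝ) - 4) / √((n : ℝ) - 1) + 2 / √((n : ℝ) + 1) + 2 / √5 + 1 / √6 := by
  classical
  have hpq' := hpq.ne
  have hpr' := hpr.ne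
  have hqr' := hqr.ne
  have hpq2 := hpq.symm
  have hpr2 := hpr.symm
  have hqr2 := hqr.symm
  have hs' : ∀ x, G.Adj x s ↔ x ∉ ({s, r} : Finset V) := fun x => by rw [G.adj_comm, hs]
  have hds : degR G s + 2 = n := by
    rw [degR_eq_card_s7 (S := {s, r}ᶜ) (by simpa using hs), ← Finset.card_pair hsr,
      Finset.card_compl_add_card, hcard]
  have hds' : (degR G s : ℝ) = n - 2 := by rw [← hds]; push_cast; ring
  have hdp : degR G p = 3 := by
    rw [degR_eq_card_s7 (S := {s, q, r}), Finset.card_eq_three.2 ⟨s, q, r, hsq, hsr, hqr', rfl⟩]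
    intro y
    have := hcov p y
    have := hs' p
    grind [SimpleGraph.irrefl]
  have hdq : degR G q = 3 := by
    rw [degR_eq_card_s7 (S := {s, p, r}), Finset.card_eq_three.2 ⟨s, p, r, hsp, hsr, hpr', rfl⟩]
    intro y
    have := hcov q y
    have := hs' q
    grind [SimpleGraph.irrefl]
  have hdr : degR G r = 2 := by
    rw [degR_eq_card_s7 (S := {p, q}), Finset.card_pair hpq']
    intro y
    have := hcov r y
    have := hs' r
    grind [SimpleGraph.irrefl]
  have hT : ∀ x ∈ ({s, p, q, r} : Finset V)ᶜ, degR G x = 1 := by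
    intro x hx
    refine degR_eq_card_s7 (S := {s}) fun y => ?_
    have := hcov x y
    have := hs' x
    simp only [Finset.mem_compl, Finset.mem_insert, Finset.mem_singleton] at *
    grind
  have hTcard : (({s, p, q, r} : Finset V)ᶜ.card : ℝ) = n - 4 := by
    have h4 : ({s, p, q, r} : Finset V).card = 4 := by
      rw [Finset.card_insert_of_notMem (by simp [hsp, hsq, hsr]),
        Finset.card_eq_three.2 ⟨p, q, r, hpq', hpr', hqr', rfl⟩]
    rw [Finset.card_compl, h4, hcard, Nat.cast_sub (by omega)]
    norm_num
  have hS : sumConn G = _ := sum_edgeSet_of_cover_three G _ hsp hsq hpq' (fun x y hxy => by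
    have := hcov x y hxy
    have := hxy.ne
    grind)
  have hNs : ({x | G.Adj s x} : Finset V) = ({s, p, q, r} : Finset V)ᶜ ∪ {p, q} := by
    ext x
    simp only [Finset.mem_filter, Finset.mem_univ, true_and, Finset.mem_union, Finset.mem_compl,
      Finset.mem_insert, Finset.mem_singleton, hs]
    grind
  have hNp : ({x | G.Adj p x ∧ x ≠ s} : Finset V) = {q, r} := by
    ext x
    have := hcov p x
    grind [SimpleGraph.irrefl]
  have hNq : ({x | G.Adj q x ∧ x ≠ s ∧ x ≠ p} : Finset V) = {r} := by
    ext x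
    have := hcov q x
    grind [SimpleGraph.irrefl]
  rw [hNs, hNp, hNq, Finset.sum_union (by rw [Finset.disjoint_left]; grind)] at hS
  simp only [Sym2.lift_mk] at hS
  rw [Finset.sum_congr rfl fun x hx => by rw [hT x hx], Finset.sum_pair hpq',
    Finset.sum_pair hqr', Finset.sum_singleton, Finset.sum_const, nsmul_eq_mul, hTcard, hds',
    hdp, hdq, hdr] at hS
  have e1 : (n : ℝ) - 2 + (1 : ℕ) = n - 1 := by push_cast; ring
  have e2 : (n : ℝ) - 2 + (3 : ℕ) = n + 1 := by push_cast; ring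
  have e3 : ((3 : ℕ) : ℝ) + (3 : ℕ) = 6 := by norm_num
  have e4 : ((3 : ℕ) : ℝ) + (2 : ℕ) = 5 := by norm_num
  rw [e1, e2, e3, e4] at hS
  rw [hS]
  ring

lemma minSumConn_lt_of_triangle {V : Type*} [Fintype V] {G : SimpleGraph V}
    {n : ℕ} (hn : 6 ≤ n) (hcard : Fintype.card V = n) (hedges : G.edgeSet.ncard = n + 1)
    {s p q r : V} (hsp : s ≠ p) (hsq : s ≠ q) (hsr : s ≠ r) (hpq : G.Adj p q) (hpr : G.Adj p r)
    (hqr : G.Adj q r) (hdeg : ∀ x, ∃ y, G.Adj x y)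
    (hcov : ∀ x y, G.Adj x y → x = s ∨ y = s ∨
      ((x = p ∨ x = q ∨ x = r) ∧ (y = p ∨ y = q ∨ y = r))) :
    minSumConn n < sumConn G := by
  classical
  have hpq' := hpq.ne
  have hpr' := hpr.ne
  have hqr' := hqr.ne
  have hE := sum_edgeSet_of_cover_three G (fun _ => 1) hsp hsq hpq' (fun x y hxy => by
    have := hcov x y hxy
    have := hxy.ne
    grind)
  have hNp : ({x | G.Adj p x ∧ x ≠ s} : Finset V) = {q, r} := by
    ext x
    have := hcov p x
    grind [SimpleGraph.irrefl]
  have hNq : ({x | G.Adj q x ∧ x ≠ s ∧ x ≠ p} : Finset V) = {r} := by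
    ext x
    have := hcov q x
    grind [SimpleGraph.irrefl]
  rw [hNp, hNq] at hE
  simp only [Finset.sum_const, nsmul_eq_mul, mul_one, ← Set.ncard_eq_toFinset_card, hedges,
    Finset.card_pair hqr', Finset.card_singleton] at hE
  have hE' : n + 1 = ({x | G.Adj s x} : Finset V).card + 2 + 1 := by exact_mod_cast hE
  have hcompl := Finset.card_filter_add_card_filter_not (s := Finset.univ) (fun x => G.Adj s x)
  rw [Finset.card_univ, hcard] at hcompl
  obtain ⟨x, y, hxy, hset⟩ := Finset.card_eq_two.1
    (show ({x | ¬ G.Adj s x} : Finset V).card = 2 by omega)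
  obtain ⟨t, hst, hset⟩ : ∃ t, s ≠ t ∧ ({x | ¬ G.Adj s x} : Finset V) = {s, t} := by
    have : s ∈ ({x | ¬ G.Adj s x} : Finset V) := by simp
    rw [hset, Finset.mem_insert, Finset.mem_singleton] at this
    rcases this with rfl | rfl
    · exact ⟨y, hxy, hset⟩
    · exact ⟨x, hxy.symm, by rw [hset, Finset.pair_comm]⟩
  have hs : ∀ x, G.Adj s x ↔ x ∉ ({s, t} : Finset V) := fun x => by
    rw [← hset]; simp
  have ht : t = p ∨ t = q ∨ t = r := by
    obtain ⟨y, hy⟩ := hdeg t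
    have := hcov t y hy
    have := hs t
    have := hy.symm
    grind
  rcases ht with rfl | rfl | rfl
  · rw [sumConn_of_triangle hcard hn hsq hsr hsp hqr hpq.symm hpr.symm hs
      fun x y h => by have := hcov x y h; tauto]
    exact minSumConn_lt_triangle hn
  · rw [sumConn_of_triangle hcard hn hsp hsr hsq hpr hpq hqr.symm hs
      fun x y h => by have := hcov x y h; tauto]
    exact minSumConn_lt_triangle hn
  · rw [sumConn_of_triangle hcard hn hsp hsq hsr hpq hpr hqr hs hcov]
    exact minSumConn_lt_triangle hn

/-- The four vertices of the underlying `K₄` minus an edge in `B_n(a,b)`. -/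
def babCore (a b : ℕ) : Fin 4 ↪ BabVert a b := ⟨Sum.inl, Sum.inl_injective⟩

lemma babGraph_three_adj {a : ℕ} (x y : BabVert a 3) :
    (BabGraph a 3).Adj x y ↔ x ≠ y ∧ (x = babCore a 3 0 ∨ y = babCore a 3 0 ∨
      (x = babCore a 3 1 ∧ (y = babCore a 3 2 ∨ y = babCore a 3 3)) ∨
      (y = babCore a 3 1 ∧ (x = babCore a 3 2 ∨ x = babCore a 3 3))) := by
  have key : ∀ x y : Fin 4 ⊕ Fin (a - 3) ⊕ Fin (3 - 3),
      (x ≠ y ∧ (BabRel a 3 x y ∨ BabRel a 3 y x)) ↔ x ≠ y ∧ (x = Sum.inl 0 ∨ y = Sum.inl 0 ∨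
        (x = Sum.inl 1 ∧ (y = Sum.inl 2 ∨ y = Sum.inl 3)) ∨
        (y = Sum.inl 1 ∧ (x = Sum.inl 2 ∨ x = Sum.inl 3))) := by
    rintro (i | i | i) (j | j | j)
    · fin_cases i <;> fin_cases j <;> simp [BabRel]
    all_goals first | exact i.elim0 | exact j.elim0 | simp [BabRel]
  exact key x y

lemma card_babVert (a b : ℕ) : Fintype.card (BabVert a b) = 4 + (a - 3 + (b - 3)) := by
  change Fintype.card (Fin 4 ⊕ Fin (a - 3) ⊕ Fin (b - 3)) = _
  simp

lemma nonempty_iso_babGraph_three {V : Type*} [Fintype V] {G : SimpleGraph V} {a : ℕ}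
    (ha : 3 ≤ a) (hcard : Fintype.card V = a + 1) {u v c d : V} (huv : u ≠ v) (huc : u ≠ c)
    (hud : u ≠ d) (hvc : v ≠ c) (hvd : v ≠ d) (hcd : c ≠ d)
    (hadj : ∀ x y, G.Adj x y ↔ x ≠ y ∧ (x = u ∨ y = u ∨ (x = v ∧ (y = c ∨ y = d)) ∨
      (y = v ∧ (x = c ∨ x = d)))) : Nonempty (G ≃g BabGraph a 3) := by
  have e : BabVert a 3 ≃ V := Fintype.equivOfCardEq (by rw [card_babVert, hcard]; omega)
  let f : Fin 4 ↪ V := (babCore a 3).trans e.toEmbedding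
  let g : Fin 4 ↪ V := ⟨![u, v, c, d], by
    intro i j
    fin_cases i <;> fin_cases j <;> simp [huv, huc, hud, hvc, hvd, hcd, Ne.symm]⟩
  obtain ⟨σ, hσ⟩ := (Equiv.Perm.isMultiplyPretransitive V 4).exists_smul_eq f g
  have h : ∀ i, σ (e (babCore a 3 i)) = g i := fun i => DFunLike.congr_fun hσ i
  have h0 : σ (e (babCore a 3 0)) = u := h 0
  have h1 : σ (e (babCore a 3 1)) = v := h 1
  have h2 : σ (e (babCore a 3 2)) = c := h 2
  have h3 : σ (e (babCore a 3 3)) = d := h 3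
  refine ⟨SimpleGraph.Iso.symm ⟨e.trans σ, fun {x y} => ?_⟩⟩
  rw [hadj, babGraph_three_adj, ← h0, ← h1, ← h2, ← h3]
  simp only [Equiv.trans_apply, EmbeddingLike.apply_eq_iff_eq, ne_eq]

lemma sumConn_eq_of_iso_babGraph {V : Type*} [Fintype V] {G : SimpleGraph V} {n : ℕ} (hn : 6 ≤ n)
    (hcard : Fintype.card V = n) (hdeg : ∀ x, ∃ y, G.Adj x y) (hedges : G.edgeSet.ncard = n + 1)
    (e : G ≃g BabGraph (n - 1) 3) : sumConn G = minSumConn n := by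
  classical
  have hadj : ∀ x y, G.Adj x y ↔ _ := fun x y =>
    e.map_adj_iff.symm.trans (babGraph_three_adj (e x) (e y))
  have huv : e.symm (babCore _ _ 0) ≠ e.symm (babCore _ _ 1) := fun h => by
    simpa using (babCore _ _).injective (e.symm.injective h)
  have hu : ∀ x, G.Adj (e.symm (babCore _ _ 0)) x ↔ x ∈ ({e.symm (babCore _ _ 0)} : Finset V)ᶜ := by
    intro x
    rw [hadj]
    simp only [e.apply_symm_apply, true_or, and_true, Finset.mem_compl, Finset.mem_singleton, ne_eq,
      eq_comm (a := x), e.symm_apply_eq]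
  have hcov : ∀ x y, G.Adj x y → x = e.symm (babCore _ _ 0) ∨ x = e.symm (babCore _ _ 1) ∨
      y = e.symm (babCore _ _ 0) ∨ y = e.symm (babCore _ _ 1) := by
    intro x y hxy
    rw [hadj] at hxy
    have hsymm : ∀ x z, x = e.symm z ↔ e x = z := fun x z => e.toEquiv.eq_symm_apply
    simp only [hsymm]
    tauto
  have hdu := degR_eq_card_s7 hu
  rw [Finset.card_compl, Finset.card_singleton, hcard] at hdu
  obtain ⟨-, -, h | h⟩ := sumConn_of_cover_two hn hcard hdeg hedges huv hcov
  · obtain ⟨-, -, h1, h2⟩ := h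
    have hdv : degR G (e.symm (babCore _ _ 1)) = 3 := by omega
    rw [h2, hdu, hdv, minSumConn_eq, Nat.cast_sub (by omega), add_comm (starWeight 2 _)]
    norm_num
  · exact absurd ((hu _).2 (by simp)) h.1

lemma nonempty_iso_of_degR_eq_three {V : Type*} [Fintype V] [DecidableEq V] {G : SimpleGraph V}
    [DecidableRel G.Adj] {n : ℕ} (hn : 6 ≤ n) (hcard : Fintype.card V = n) {u v : V}
    (huv : G.Adj u v) (hcov : ∀ x y, G.Adj x y → x = u ∨ x = v ∨ y = u ∨ y = v)
    (hC : ({x | G.Adj u x ∧ G.Adj v x} : Finset V).card = 2)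
    (hdeg : degR G u + degR G v = n + 2) (hv : degR G v = 3) :
    Nonempty (G ≃g BabGraph (n - 1) 3) := by
  obtain ⟨c, d, hcd, hC⟩ := Finset.card_eq_two.1 hC
  have hC' : ∀ x, G.Adj u x ∧ G.Adj v x ↔ x = c ∨ x = d := fun x => by
    simpa using Finset.ext_iff.1 hC x
  obtain ⟨huc, hvc⟩ := (hC' c).2 (Or.inl rfl)
  obtain ⟨hud, hvd⟩ := (hC' d).2 (Or.inr rfl)
  have hNu : ({x | G.Adj u x} : Finset V) = {u}ᶜ := by
    refine Finset.eq_of_subset_of_card_le (fun x hx => ?_) ?_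
    · simpa using (show G.Adj u x by simpa using hx).ne'
    · rw [← degR_eq_card_filter, Finset.card_compl, Finset.card_singleton, hcard]
      omega
  have hNv : ({u, c, d} : Finset V) = ({x | G.Adj v x} : Finset V) := by
    refine Finset.eq_of_subset_of_card_le (fun x hx => ?_) ?_
    · simp only [Finset.mem_insert, Finset.mem_singleton] at hx
      rcases hx with rfl | rfl | rfl <;> simp [huv.symm, hvc, hvd]
    · rw [← degR_eq_card_filter, hv, Finset.card_eq_three.2 ⟨u, c, d, huc.ne, hud.ne, hcd, rfl⟩]
  have hu : ∀ x, G.Adj u x ↔ u ≠ x := fun x => by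
    simpa [eq_comm] using Finset.ext_iff.1 hNu x
  have hv' : ∀ x, G.Adj v x ↔ x = u ∨ x = c ∨ x = d := fun x => by
    simpa using (Finset.ext_iff.1 hNv x).symm
  refine nonempty_iso_babGraph_three (by omega) (by omega) huv.ne huc.ne hud.ne hvc.ne hvd.ne hcd
    fun x y => ?_
  have := hcov x y
  have := hu x
  have := hu y
  have := hv' x
  have := hv' y
  have := G.adj_comm x y
  have := huv.ne
  have := hvc.ne
  have := hvd.ne
  grind

lemma minSumConn_le_of_cover_two {V : Type*} [Fintype V] {G : SimpleGraph V} {n : ℕ} (hn : 6 ≤ n)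
    (hcard : Fintype.card V = n) (hdeg : ∀ x, ∃ y, G.Adj x y) (hedges : G.edgeSet.ncard = n + 1)
    {u v : V} (huv : u ≠ v) (hcov : ∀ x y, G.Adj x y → x = u ∨ x = v ∨ y = u ∨ y = v) :
    minSumConn n ≤ sumConn G ∧
      (sumConn G = minSumConn n → Nonempty (G ≃g BabGraph (n - 1) 3)) := by
  classical
  obtain ⟨hu, hv, ⟨hadj, hC, hsum, hS⟩ | ⟨-, hsum, hS⟩⟩ :=
    sumConn_of_cover_two hn hcard hdeg hedges huv hcov
  · have hsum' : (degR G u : ℝ) + degR G v = 3 + (n - 1) := by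
      have : (degR G u : ℝ) + degR G v = n + 2 := by exact_mod_cast hsum
      linarith
    rw [hS, minSumConn_eq]
    refine ⟨add_le_add_right (starWeight_add_le (by norm_num)
      (Nat.ofNat_le_cast.2 hu) (Nat.ofNat_le_cast.2 hv) hsum') _, fun heq => ?_⟩
    rcases hv.eq_or_lt with hv | hv
    · exact nonempty_iso_of_degR_eq_three hn hcard hadj hcov hC hsum hv.symm
    rcases hu.eq_or_lt with hu | hu
    · refine nonempty_iso_of_degR_eq_three hn hcard hadj.symm (fun x y h => ?_) ?_ (by omega)
        hu.symm
      · have := hcov x y h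
        tauto
      · simpa only [and_comm] using hC
    · linarith [starWeight_add_lt (c := 2) (by norm_num) (Nat.ofNat_lt_cast.2 hu)
        (Nat.ofNat_lt_cast.2 hv) hsum']
  · have hsum' : (degR G u : ℝ) + degR G v = 3 + (n - 2) := by
      have : (degR G u : ℝ) + degR G v = n + 1 := by exact_mod_cast hsum
      linarith
    have hlt : minSumConn n < sumConn G := by
      rw [hS]
      exact (minSumConn_lt_starWeight hn).trans_le (starWeight_add_le (by norm_num)
        (Nat.ofNat_le_cast.2 hu) (Nat.ofNat_le_cast.2 hv) hsum')
    exact ⟨hlt.le, fun h => absurd h hlt.ne'⟩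

lemma minSumConn_le_of_hasTightCover {V : Type*} [Fintype V] {G : SimpleGraph V} {n : ℕ}
    (hn : 6 ≤ n) (hcard : Fintype.card V = n) (hdeg : ∀ x, ∃ y, G.Adj x y)
    (hedges : G.edgeSet.ncard = n + 1) (hG : HasTightCover G) :
    minSumConn n ≤ sumConn G ∧
      (sumConn G = minSumConn n → Nonempty (G ≃g BabGraph (n - 1) 3)) := by
  by_cases h2 : ∃ u v, u ≠ v ∧ ∀ x y, G.Adj x y → x = u ∨ x = v ∨ y = u ∨ y = v
  · obtain ⟨u, v, huv, hcov⟩ := h2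
    exact minSumConn_le_of_cover_two hn hcard hdeg hedges huv hcov
  obtain ⟨s, p, q, r, hsp, hsq, hsr, hpq, hpr, hqr, hcov⟩ := hG.resolve_left h2
  have hadj : ∀ {p q r}, s ≠ r → (∀ x y, G.Adj x y → x = s ∨ y = s ∨
      ((x = p ∨ x = q ∨ x = r) ∧ (y = p ∨ y = q ∨ y = r))) → G.Adj p q := by
    intro p q r hsr hcov
    by_contra hpq
    refine h2 ⟨s, r, hsr, fun x y hxy => ?_⟩
    have := hcov x y hxy
    have := hxy.ne
    have := hxy.symm
    grind
  have hlt := minSumConn_lt_of_triangle hn hcard hedges hsp hsq hsr (hadj hsr hcov)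
    (hadj hsq fun x y h => by have := hcov x y h; tauto)
    (hadj hsp fun x y h => by have := hcov x y h; tauto) hdeg hcov
  exact ⟨hlt.le, fun h => absurd h hlt.ne'⟩

/-- Let `n ≥ 6` and let `G` be a bicyclic graph with `n` vertices and matching number
`2`. Then `χ(G) ≥ 1/√(n+2) + (n−4)/√n + 2/√(n+1) + 2/√5`, with equality if and only
if `G ≅ B_n(n−1, 3)`. -/
theorem stmt_7 {V : Type*} [Fintype V] (G : SimpleGraph V) (n : ℕ) (hn : 6 ≤ n)
    (hcard : Fintype.card V = n) (hconn : G.Connected)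
    (hedges : G.edgeSet.ncard = n + 1)
    (hmatch : matchingNumber G = 2) :
    sumConn G ≥ 1 / Real.sqrt ((n : ℝ) + 2) + ((n : ℝ) - 4) / Real.sqrt (n : ℝ) +
        2 / Real.sqrt ((n : ℝ) + 1) + 2 / Real.sqrt 5 ∧
    (sumConn G = 1 / Real.sqrt ((n : ℝ) + 2) + ((n : ℝ) - 4) / Real.sqrt (n : ℝ) +
        2 / Real.sqrt ((n : ℝ) + 1) + 2 / Real.sqrt 5 ↔
      Nonempty (G ≃g BabGraph (n - 1) 3)) := by
  have hdeg := exists_adj_of_connected hconn (by omega)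
  obtain ⟨hle, hiso⟩ := minSumConn_le_of_hasTightCover hn hcard hdeg hedges
    (hasTightCover_of_matchingNumber_eq_two hconn (by omega) hmatch)
  exact ⟨hle, hiso, fun ⟨e⟩ => sumConn_eq_of_iso_babGraph hn hcard hdeg hedges e⟩
end
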